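/- There exist universal constants C > 0 and c > 0 with the following property. Let t > 0, ε > 0, M ≥ 1 with M·ε·t^{1/3} ≤ c, and let u : ℝ → ℝ be a Schwartz function satisfying the bootstrap bounds with constants M, ε at time t, as well as ‖u‖_{Ḃ^{-1/2}_{2,∞}} + ‖L^{NL}u(t)‖_{Ḣ^{1/2}} ≤ ε. Then for all x ≥ 2t^{1/3}: ⟨x⟩|u(x)| + t^{1/2}⟨x⟩^{1/2}|u'(x)| ≤ C·ε·ln(t^{-1/3}⟨x⟩). -/

import Mathlib

open MeasureTheory Real SchwartzMap Set
open scoped FourierTransform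

noncomputable section

/-- Fourier transform of a real-valued function on `ℝ`. -/
def FT (u : ℝ → ℝ) : ℝ → ℂ := 𝓕 (fun x => (u x : ℂ))

/-- Homogeneous Sobolev norm `‖u‖_{Ḣˢ}`. -/
def HsNorm (s : ℝ) (u : ℝ → ℝ) : ℝ :=
  (∫ ξ : ℝ, |ξ| ^ (2 * s) * ‖FT u ξ‖ ^ 2) ^ (1/2 : ℝ)

/-- Homogeneous Besov norm `‖u‖_{Ḃ^{-1/2}_{2,∞}}`. -/
def BesovNorm (u : ℝ → ℝ) : ℝ :=
  ⨆ j : ℤ, (2:ℝ) ^ (-(j:ℝ)/2) *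
    (∫ ξ in {ξ : ℝ | (2:ℝ)^j ≤ |ξ| ∧ |ξ| < (2:ℝ)^(j+1)}, ‖FT u ξ‖^2) ^ (1/2:ℝ)

/-- `L²` norm. -/
def L2Norm (u : ℝ → ℝ) : ℝ := (∫ x : ℝ, u x ^ 2) ^ (1/2:ℝ)

/-- `L²` norm restricted to a set. -/
def L2NormOn (A : Set ℝ) (u : ℝ → ℝ) : ℝ := (∫ x in A, u x ^ 2) ^ (1/2:ℝ)

/-- The time-dependent japanese bracket `⟨x⟩ = (x² + t^{2/3})^{1/2}`. -/
def jb (t x : ℝ) : ℝ := (x^2 + t ^ ((2:ℝ)/3)) ^ (1/2:ℝ)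

/-- The bootstrap bounds with constants `M`, `ε` at time `t`. -/
def Bootstrap (M ε t : ℝ) (u : ℝ → ℝ) : Prop :=
  ∀ x : ℝ, |u x| ≤ M * ε * t ^ (-(1:ℝ)/4) * jb t x ^ (-(1:ℝ)/4) ∧
    |deriv u x| ≤ M * ε * t ^ (-(3:ℝ)/4) * jb t x ^ ((1:ℝ)/4)

/-- The nonlinear operator `L^{NL}u(t)(x) = x·u(x) - 3t·u''(x) + 9t·u(x)²`. -/
def LNL (t : ℝ) (u : ℝ → ℝ) : ℝ → ℝ :=
  fun x => x * u x - 3 * t * iteratedDeriv 2 u x + 9 * t * u x ^ 2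

theorem integrableOn_pow_mul_exp_neg (n : ℕ) {μ : ℝ} (hμ : 0 < μ) :
    IntegrableOn (fun s : ℝ => s ^ n * Real.exp (-(μ * s))) (Ioi 0) := by
  have h := integrableOn_rpow_mul_exp_neg_mul_rpow (s := n) (p := 1) (b := μ)
    (by have : (0:ℝ) ≤ n := n.cast_nonneg
        linarith) one_pos hμ
  refine h.congr_fun (fun s _ => ?_) measurableSet_Ioi
  simp [Real.rpow_natCast]

theorem integrableOn_pow_mul_cexp_neg (n : ℕ) {w : ℂ} (hw : 0 < w.re) :
    IntegrableOn (fun s : ℝ => (s : ℂ) ^ n * Complex.exp (-(w * s))) (Ioi 0) := by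
  refine (integrableOn_pow_mul_exp_neg n hw).mono' (by fun_prop) ?_
  filter_upwards [ae_restrict_mem measurableSet_Ioi] with s hs
  rw [norm_mul, norm_pow, Complex.norm_real, Complex.norm_exp, Real.norm_of_nonneg (le_of_lt hs)]
  simp

theorem tendsto_pow_mul_exp_neg (n : ℕ) {μ : ℝ} (hμ : 0 < μ) :
    Filter.Tendsto (fun s : ℝ => s ^ n * Real.exp (-(μ * s))) Filter.atTop (nhds 0) := by
  have h := tendsto_rpow_mul_exp_neg_mul_atTop_nhds_zero n μ hμ
  simpa [Real.rpow_natCast] using h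

theorem tendsto_pow_mul_cexp_neg (n : ℕ) {w : ℂ} (hw : 0 < w.re) :
    Filter.Tendsto (fun s : ℝ => (s : ℂ) ^ n * Complex.exp (-(w * s))) Filter.atTop (nhds 0) := by
  rw [tendsto_zero_iff_norm_tendsto_zero]
  refine (tendsto_pow_mul_exp_neg n hw).congr' ?_
  filter_upwards [Filter.eventually_ge_atTop 0] with s hs
  rw [norm_mul, norm_pow, Complex.norm_real, Complex.norm_exp, Real.norm_of_nonneg hs]
  simp

/-- The Laplace transform of a monomial. -/
theorem integral_pow_mul_cexp_neg (n : ℕ) {w : ℂ} (hw : 0 < w.re) :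
    ∫ s : ℝ in Ioi 0, (s : ℂ) ^ n * Complex.exp (-(w * s)) = n.factorial / w ^ (n + 1) := by
  have hw0 : w ≠ 0 := by rintro rfl; simp at hw
  have hexp (s : ℝ) : HasDerivAt (fun s : ℝ => Complex.exp (-(w * s)))
      (-w * Complex.exp (-(w * s))) s := by
    have h : HasDerivAt (fun z : ℂ => -(w * z)) (-w) (s : ℂ) := by
      simpa using (hasDerivAt_id (s : ℂ)).const_mul (-w)
    exact h.cexp.comp_ofReal.congr_deriv (by ring)
  induction n with
  | zero =>
    have h := integral_Ioi_of_hasDerivAt_of_tendsto' (a := (0:ℝ)) (fun s _ => hexp s)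
      (by simpa [IntegrableOn] using (integrableOn_pow_mul_cexp_neg 0 hw).const_mul (-w))
      (by simpa using tendsto_pow_mul_cexp_neg 0 hw)
    rw [integral_const_mul] at h
    simp only [pow_zero, one_mul, Nat.factorial_zero, Nat.cast_one, zero_add, pow_one]
    field_simp
    simpa using h
  | succ n ih =>
    have hd (s : ℝ) : HasDerivAt (fun s : ℝ => (s : ℂ) ^ (n + 1) * Complex.exp (-(w * s)))
        ((n + 1) * ((s : ℂ) ^ n * Complex.exp (-(w * s)))
          - w * ((s : ℂ) ^ (n + 1) * Complex.exp (-(w * s)))) s := by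
      have h1 : HasDerivAt (fun s : ℝ => (s : ℂ) ^ (n + 1)) ((n + 1) * (s : ℂ) ^ n) s := by
        simpa using (hasDerivAt_pow (n + 1) (s : ℂ)).comp_ofReal
      exact (h1.mul (hexp s)).congr_deriv (by ring)
    have i1 := (integrableOn_pow_mul_cexp_neg n hw).const_mul ((n : ℂ) + 1)
    have i2 := (integrableOn_pow_mul_cexp_neg (n + 1) hw).const_mul w
    have h := integral_Ioi_of_hasDerivAt_of_tendsto' (a := (0:ℝ)) (fun s _ => hd s)
      (i1.sub i2) (tendsto_pow_mul_cexp_neg (n + 1) hw)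
    rw [integral_sub i1 i2, integral_const_mul, integral_const_mul, ih] at h
    simp only [Complex.ofReal_zero, ne_eq, Nat.add_eq_zero_iff, one_ne_zero, and_false,
      not_false_eq_true, zero_pow, zero_mul, sub_zero] at h
    rw [Nat.factorial_succ]
    push_cast
    field_simp at h ⊢
    linear_combination -h

/-- One-sided exponentially weighted moments: the Laplace transform at `μ` of
`s ↦ s ^ n * g (x₀ + σ s)`. -/
def halfLap (n : ℕ) (μ x₀ σ : ℝ) (g : ℝ → ℝ) : ℝ :=
  ∫ s in Ioi (0:ℝ), s ^ n * Real.exp (-(μ * s)) * g (x₀ + σ * s)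

/-- A Schwartz function, regarded as complex valued. -/
def complexify (u : 𝓢(ℝ, ℝ)) : 𝓢(ℝ, ℂ) := SchwartzMap.postcompCLM Complex.ofRealCLM u

theorem complexify_apply (u : 𝓢(ℝ, ℝ)) (x : ℝ) : complexify u x = (u x : ℂ) := rfl

theorem FT_eq (u : 𝓢(ℝ, ℝ)) : FT u = 𝓕 (complexify u) := rfl

theorem FT_apply (u : 𝓢(ℝ, ℝ)) (ξ : ℝ) : FT u ξ = (𝓕 (complexify u)) ξ := by
  rw [FT_eq]

/-- The Fourier multiplier attached to `halfLap n μ x₀ σ`. -/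
def lapSymbol (n : ℕ) (μ x₀ σ ξ : ℝ) : ℂ :=
  Complex.exp ((2 * π * x₀ * ξ : ℝ) * Complex.I) *
    (n.factorial / ((μ : ℂ) - (2 * π * σ * ξ : ℝ) * Complex.I) ^ (n + 1))

theorem fourier_inversion_apply (F : 𝓢(ℝ, ℂ)) (x : ℝ) :
    F x = ∫ ξ : ℝ, Complex.exp ((2 * π * (x * ξ) : ℝ) * Complex.I) * (𝓕 F) ξ := by
  have h : (𝓕⁻ (𝓕 F) : 𝓢(ℝ, ℂ)) x = F x := by rw [FourierTransform.fourierInv_fourier_eq]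
  rw [← h, SchwartzMap.fourierInv_coe, Real.fourierInv_eq']
  refine integral_congr_ae (Filter.Eventually.of_forall fun ξ => ?_)
  simp [mul_comm, mul_left_comm]

theorem halfLap_eq_integral_fourier (n : ℕ) {μ : ℝ} (hμ : 0 < μ) (x₀ σ : ℝ) (u : 𝓢(ℝ, ℝ)) :
    (halfLap n μ x₀ σ u : ℂ) = ∫ ξ : ℝ, lapSymbol n μ x₀ σ ξ * FT u ξ := by
  set F := complexify u
  have hint : Integrable (Function.uncurry fun (s ξ : ℝ) =>
      ((s : ℂ) ^ n * Complex.exp (-(μ * s))) *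
        (Complex.exp ((2 * π * ((x₀ + σ * s) * ξ) : ℝ) * Complex.I) * (𝓕 F) ξ))
      ((volume.restrict (Ioi 0)).prod volume) := by
    have h1 : Integrable (fun s : ℝ => (s : ℂ) ^ n * Complex.exp (-((μ : ℂ) * s)))
        (volume.restrict (Ioi 0)) := integrableOn_pow_mul_cexp_neg n (by simpa using hμ)
    have h2 := h1.mul_prod ((𝓕 F).integrable (μ := volume))
    refine h2.mono ?_ (Filter.Eventually.of_forall fun p => ?_)
    · apply Continuous.aestronglyMeasurable
      have := (𝓕 F).continuous
      simp only [Function.uncurry_def]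
      fun_prop
    · rcases p with ⟨s, ξ⟩
      simp only [Function.uncurry_apply_pair, norm_mul]
      rw [Complex.norm_exp_ofReal_mul_I, one_mul]
  calc (halfLap n μ x₀ σ u : ℂ)
      = ∫ s in Ioi (0:ℝ), ∫ ξ : ℝ, ((s : ℂ) ^ n * Complex.exp (-(μ * s))) *
        (Complex.exp ((2 * π * ((x₀ + σ * s) * ξ) : ℝ) * Complex.I) * (𝓕 F) ξ) := by
        rw [halfLap, ← integral_complex_ofReal]
        refine integral_congr_ae (Filter.Eventually.of_forall fun s => ?_)
        simp only [integral_const_mul]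
        rw [← fourier_inversion_apply F (x₀ + σ * s), complexify_apply]
        push_cast
        ring
    _ = ∫ ξ : ℝ, ∫ s in Ioi (0:ℝ), ((s : ℂ) ^ n * Complex.exp (-(μ * s))) *
        (Complex.exp ((2 * π * ((x₀ + σ * s) * ξ) : ℝ) * Complex.I) * (𝓕 F) ξ) :=
        integral_integral_swap hint
    _ = _ := by
        refine integral_congr_ae (Filter.Eventually.of_forall fun ξ => ?_)
        simp only [lapSymbol]
        rw [← integral_pow_mul_cexp_neg n (w := (μ : ℂ) - (2 * π * σ * ξ : ℝ) * Complex.I)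
          (by simpa using hμ), ← integral_const_mul, ← integral_mul_const, FT_apply]
        refine integral_congr_ae (Filter.Eventually.of_forall fun s => ?_)
        have : Complex.exp (-(μ * s)) * Complex.exp ((2 * π * ((x₀ + σ * s) * ξ) : ℝ) * Complex.I)
            = Complex.exp ((2 * π * x₀ * ξ : ℝ) * Complex.I) *
              Complex.exp (-(((μ : ℂ) - (2 * π * σ * ξ : ℝ) * Complex.I) * s)) := by
          rw [← Complex.exp_add, ← Complex.exp_add]
          congr 1
          push_cast
          ring
        linear_combination ((s : ℂ) ^ n * (𝓕 F) ξ) * this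

theorem norm_lapSymbol (n : ℕ) (μ x₀ σ ξ : ℝ) :
    ‖lapSymbol n μ x₀ σ ξ‖ =
      n.factorial / ‖(μ : ℂ) - (2 * π * σ * ξ : ℝ) * Complex.I‖ ^ (n + 1) := by
  rw [lapSymbol, norm_mul, Complex.norm_exp_ofReal_mul_I, one_mul, norm_div, norm_pow,
    Complex.norm_natCast]

theorem norm_sq_sub_mul_I (a b : ℝ) : ‖(a : ℂ) - (b : ℝ) * Complex.I‖ ^ 2 = a ^ 2 + b ^ 2 := by
  rw [← Complex.normSq_eq_norm_sq, Complex.normSq_apply]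
  simp
  ring

theorem continuous_lapSymbol (n : ℕ) {μ : ℝ} (hμ : 0 < μ) (x₀ σ : ℝ) :
    Continuous (lapSymbol n μ x₀ σ) := by
  unfold lapSymbol
  refine Continuous.mul (by fun_prop) (Continuous.div (by fun_prop) (by fun_prop) fun ξ h => ?_)
  have := norm_sq_sub_mul_I μ (2 * π * σ * ξ)
  rw [pow_eq_zero_iff (by omega)] at h
  rw [h] at this
  simp at this
  nlinarith [sq_nonneg (2 * π * σ * ξ), sq_pos_of_pos hμ]

/-- The dyadic annulus `2 ^ j ≤ |ξ| < 2 ^ (j + 1)`. -/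
def annulus (j : ℤ) : Set ℝ := {ξ : ℝ | (2:ℝ) ^ j ≤ |ξ| ∧ |ξ| < (2:ℝ) ^ (j + 1)}

theorem measurableSet_annulus (j : ℤ) : MeasurableSet (annulus j) :=
  (measurableSet_le measurable_const continuous_abs.measurable).inter
    (measurableSet_lt continuous_abs.measurable measurable_const)

theorem annulus_subset_Icc (j : ℤ) :
    annulus j ⊆ Icc (-(2:ℝ) ^ (j + 1)) ((2:ℝ) ^ (j + 1)) :=
  fun _ hξ => abs_le.mp hξ.2.le

theorem volume_annulus_ne_top (j : ℤ) : volume (annulus j) ≠ ⊤ :=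
  ((measure_mono (annulus_subset_Icc j)).trans_lt (by simp)).ne

theorem volume_real_annulus_le (j : ℤ) : volume.real (annulus j) ≤ 4 * (2:ℝ) ^ j := by
  refine (measureReal_mono (annulus_subset_Icc j) (by simp)).trans ?_
  rw [Real.volume_real_Icc_of_le (by have : (0:ℝ) < 2 ^ (j + 1) := by positivity
                                     linarith), zpow_add_one₀ two_ne_zero]
  linarith

theorem pairwise_disjoint_annulus : Pairwise (Function.onFun Disjoint annulus) := by
  intro i j hij
  rw [Function.onFun, Set.disjoint_left]
  rintro ξ ⟨h1, h2⟩ ⟨h3, h4⟩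
  have a := (zpow_lt_zpow_iff_right₀ (one_lt_two (α := ℝ))).mp (h1.trans_lt h4)
  have b := (zpow_lt_zpow_iff_right₀ (one_lt_two (α := ℝ))).mp (h3.trans_lt h2)
  omega

theorem iUnion_annulus : ⋃ j, annulus j = {0}ᶜ := by
  ext ξ
  simp only [mem_iUnion, mem_compl_iff, mem_singleton_iff]
  constructor
  · rintro ⟨j, hj⟩ rfl
    have : (0:ℝ) < 2 ^ j := by positivity
    have := hj.1
    simp at this
    linarith
  · intro h
    obtain ⟨n, hn⟩ := exists_mem_Ico_zpow (abs_pos.mpr h) (one_lt_two (α := ℝ))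
    exact ⟨n, hn⟩

theorem continuous_FT (u : 𝓢(ℝ, ℝ)) : Continuous (FT u) := by
  have : FT u = 𝓕 (complexify u) := funext (FT_apply u)
  rw [this]
  exact (𝓕 (complexify u)).continuous

theorem integrable_FT (u : 𝓢(ℝ, ℝ)) : Integrable (FT u) := by
  have : FT u = 𝓕 (complexify u) := funext (FT_apply u)
  rw [this]
  exact (𝓕 (complexify u)).integrable

theorem exists_norm_FT_le (u : 𝓢(ℝ, ℝ)) : ∃ K, 0 ≤ K ∧ ∀ ξ, ‖FT u ξ‖ ≤ K := by
  obtain ⟨K, hK⟩ := (𝓕 (complexify u)).decay 0 0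
  refine ⟨K, hK.1.le, fun ξ => ?_⟩
  simpa [FT_apply] using hK.2 ξ

theorem integrableOn_annulus_norm_FT_sq (u : 𝓢(ℝ, ℝ)) (j : ℤ) :
    IntegrableOn (fun ξ => ‖FT u ξ‖ ^ 2) (annulus j) :=
  (((continuous_FT u).norm.pow 2).continuousOn.integrableOn_compact isCompact_Icc).mono_set
    (annulus_subset_Icc j)

theorem integral_annulus_le (u : 𝓢(ℝ, ℝ)) {ε : ℝ} (hB : BesovNorm u ≤ ε) (j : ℤ) :
    ∫ ξ in annulus j, ‖FT u ξ‖ ^ 2 ≤ 2 ^ j * ε ^ 2 := by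
  obtain ⟨K, hK0, hK⟩ := exists_norm_FT_le u
  have hpow (j : ℤ) : ((2:ℝ) ^ (-(j:ℝ) / 2)) ^ 2 = ((2:ℝ) ^ j)⁻¹ := by
    rw [← Real.rpow_natCast, ← Real.rpow_mul two_pos.le, ← Real.rpow_intCast,
      ← Real.rpow_neg two_pos.le]
    congr 1
    push_cast
    ring
  have hsq (j : ℤ) : ((2:ℝ) ^ (-(j:ℝ) / 2) *
      (∫ ξ in annulus j, ‖FT u ξ‖ ^ 2) ^ (1 / 2 : ℝ)) ^ 2
      = ((2:ℝ) ^ j)⁻¹ * ∫ ξ in annulus j, ‖FT u ξ‖ ^ 2 := by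
    rw [mul_pow, hpow, ← Real.sqrt_eq_rpow, Real.sq_sqrt (integral_nonneg fun _ => by positivity)]
  have hbdd : BddAbove (range fun j : ℤ => (2:ℝ) ^ (-(j:ℝ) / 2) *
      (∫ ξ in annulus j, ‖FT u ξ‖ ^ 2) ^ (1 / 2 : ℝ)) := by
    refine ⟨2 * K, ?_⟩
    rintro _ ⟨j, rfl⟩
    refine le_of_sq_le_sq ?_ (by positivity)
    simp only
    rw [hsq, inv_mul_le_iff₀ (by positivity)]
    have h := setIntegral_mono_on (integrableOn_annulus_norm_FT_sq u j)
      (integrableOn_const (volume_annulus_ne_top j) (C := K ^ 2)) (measurableSet_annulus j)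
      (fun ξ _ => pow_le_pow_left₀ (norm_nonneg _) (hK ξ) 2)
    rw [setIntegral_const, smul_eq_mul] at h
    have := mul_le_mul_of_nonneg_right (volume_real_annulus_le j) (sq_nonneg K)
    linarith
  have h := (le_ciSup hbdd j).trans hB
  have h' := pow_le_pow_left₀ (by positivity) h 2
  rw [hsq, inv_mul_le_iff₀ (by positivity)] at h'
  exact h'

theorem hasSum_half_pow_natAbs_sub (k : ℤ) :
    HasSum (fun j : ℤ => ((1:ℝ) / 2) ^ (j - k).natAbs) 3 := by
  have h : HasSum (fun j : ℤ => ((1:ℝ) / 2) ^ j.natAbs) (2 + 1) := by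
    refine HasSum.of_nat_of_neg_add_one ?_ ?_
    · simpa using hasSum_geometric_two
    · have h := hasSum_geometric_two.mul_left ((1:ℝ) / 2)
      rw [one_div_mul_cancel two_ne_zero] at h
      have e : (fun n : ℕ => ((1:ℝ) / 2) ^ (-((n:ℤ) + 1)).natAbs)
          = fun n : ℕ => (1:ℝ) / 2 * (1 / 2) ^ n := by
        funext n
        rw [show (-((n:ℤ) + 1)).natAbs = n + 1 by omega, pow_succ']
      rwa [e]
  have h' := (Equiv.subRight k).hasSum_iff.mpr h
  norm_num [Function.comp_def] at h' ⊢
  exact h'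

theorem zpow_div_sq_add_sq_le {μ : ℝ} {k : ℤ} (hk : μ ∈ Ico ((2:ℝ) ^ k) (2 ^ (k + 1))) (j : ℤ) :
    (2:ℝ) ^ j / (μ ^ 2 + (2 ^ j) ^ 2) ≤ 2 / μ * (1 / 2) ^ (j - k).natAbs := by
  obtain ⟨h1, h2⟩ := hk
  rw [zpow_add_one₀ two_ne_zero] at h2
  have hq : (0:ℝ) < 2 ^ k := by positivity
  have hp : (0:ℝ) < 2 ^ j := by positivity
  have hμ : 0 < μ := hq.trans_le h1
  rcases le_total k j with h | h
  · have e : ((1:ℝ) / 2) ^ (j - k).natAbs = 2 ^ k / 2 ^ j := by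
      rw [one_div, inv_pow, ← zpow_natCast, Int.natAbs_of_nonneg (by omega),
        zpow_sub₀ two_ne_zero, inv_div]
    rw [e, div_mul_div_comm, div_le_div_iff₀ (by positivity) (by positivity)]
    have a := mul_nonneg (sq_nonneg ((2:ℝ) ^ j)) (sub_nonneg.mpr h2.le)
    have b : 0 ≤ (2:ℝ) ^ k * μ ^ 2 := by positivity
    nlinarith
  · have e : ((1:ℝ) / 2) ^ (j - k).natAbs = 2 ^ j / 2 ^ k := by
      rw [one_div, inv_pow, ← zpow_natCast, ← Int.natAbs_neg, Int.natAbs_of_nonneg (by omega),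
        neg_sub, zpow_sub₀ two_ne_zero, inv_div]
    rw [e, div_mul_div_comm, div_le_div_iff₀ (by positivity) (by positivity)]
    have a := mul_nonneg hμ.le (sub_nonneg.mpr h1)
    have b : μ * 2 ^ k ≤ 2 * (μ ^ 2 + (2 ^ j) ^ 2) := by nlinarith [sq_nonneg ((2:ℝ) ^ j)]
    nlinarith

theorem integrable_norm_FT_div (u : 𝓢(ℝ, ℝ)) {μ : ℝ} (hμ : 0 < μ) :
    Integrable (fun ξ => ‖FT u ξ‖ / (μ ^ 2 + ξ ^ 2)) := by
  have hc : Continuous (fun ξ : ℝ => ‖FT u ξ‖ / (μ ^ 2 + ξ ^ 2)) :=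
    (continuous_FT u).norm.div (by fun_prop) fun ξ => by positivity
  refine ((integrable_FT u).norm.div_const (μ ^ 2)).mono' hc.aestronglyMeasurable
    (Filter.Eventually.of_forall fun ξ => ?_)
  rw [Real.norm_of_nonneg (by positivity)]
  gcongr
  nlinarith [sq_nonneg ξ]

/-- Functions in `Ḃ^{-1/2}_{2,∞}` pair with multipliers decaying quadratically. -/
theorem integral_norm_FT_div_le (u : 𝓢(ℝ, ℝ)) {ε μ : ℝ} (hε : 0 < ε) (hB : BesovNorm u ≤ ε)
    (hμ : 0 < μ) : ∫ ξ, ‖FT u ξ‖ / (μ ^ 2 + ξ ^ 2) ≤ 15 * ε / μ := by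
  obtain ⟨k, hk⟩ := exists_mem_Ico_zpow hμ (one_lt_two (α := ℝ))
  have hi := integrable_norm_FT_div u hμ
  have hs := hasSum_integral_iUnion measurableSet_annulus pairwise_disjoint_annulus hi.integrableOn
  rw [iUnion_annulus, setIntegral_congr_set (t := univ) (by simp [ae_eq_univ]),
    setIntegral_univ] at hs
  have hg := (hasSum_half_pow_natAbs_sub k).mul_left (5 / 2 * ε * (2 / μ))
  have hle := hasSum_le (fun j => ?_) hs hg
  · refine hle.trans (le_of_eq ?_)
    ring
  have hj : (0:ℝ) < 2 ^ j := by positivity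
  have h1 : ∫ ξ in annulus j, ‖FT u ξ‖ / (μ ^ 2 + ξ ^ 2) ≤
      ∫ ξ in annulus j, (‖FT u ξ‖ ^ 2 * (1 / (2 * ε)) + ε / 2) * (1 / (μ ^ 2 + (2 ^ j) ^ 2)) := by
    refine setIntegral_mono_on hi.integrableOn ?_ (measurableSet_annulus j) fun ξ hξ => ?_
    · exact ((integrableOn_annulus_norm_FT_sq u j).mul_const _ |>.add
        (integrableOn_const (volume_annulus_ne_top j))).mul_const _
    · rw [div_eq_mul_one_div]
      have : ((2:ℝ) ^ j) ^ 2 ≤ ξ ^ 2 := by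
        rw [← sq_abs ξ]
        exact pow_le_pow_left₀ hj.le hξ.1 2
      gcongr
      have := sq_nonneg (‖FT u ξ‖ - ε)
      rw [mul_one_div, div_add_div _ _ (by positivity) two_ne_zero, le_div_iff₀ (by positivity)]
      nlinarith
  rw [integral_mul_const, integral_add ((integrableOn_annulus_norm_FT_sq u j).mul_const _)
    (integrableOn_const (volume_annulus_ne_top j)), integral_mul_const, setIntegral_const,
    smul_eq_mul] at h1
  have h2 := integral_annulus_le u hB j
  have h3 := volume_real_annulus_le j
  have h4 : (∫ ξ in annulus j, ‖FT u ξ‖ ^ 2) * (1 / (2 * ε)) + volume.real (annulus j) * (ε / 2)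
      ≤ 5 / 2 * ε * 2 ^ j := by
    have e : 5 / 2 * ε * 2 ^ j = 2 ^ j * ε ^ 2 * (1 / (2 * ε)) + 4 * 2 ^ j * (ε / 2) := by
      field_simp
      ring
    rw [e]
    gcongr
  calc _ ≤ _ := h1
    _ ≤ 5 / 2 * ε * 2 ^ j * (1 / (μ ^ 2 + (2 ^ j) ^ 2)) := by gcongr
    _ = 5 / 2 * ε * (2 ^ j / (μ ^ 2 + (2 ^ j) ^ 2)) := by ring
    _ ≤ 5 / 2 * ε * (2 / μ * (1 / 2) ^ (j - k).natAbs) := by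
        gcongr
        exact zpow_div_sq_add_sq_le hk j
    _ = _ := by ring

theorem sq_add_sq_le_norm_sq {σ : ℝ} (hσ : σ ^ 2 = 1) (μ ξ : ℝ) :
    μ ^ 2 + ξ ^ 2 ≤ ‖(μ : ℂ) - (2 * π * σ * ξ : ℝ) * Complex.I‖ ^ 2 := by
  rw [norm_sq_sub_mul_I, mul_pow, mul_pow, hσ, mul_one]
  have : 1 ≤ (2 * π) ^ 2 := by nlinarith [Real.pi_gt_three]
  nlinarith [mul_le_mul_of_nonneg_right this (sq_nonneg ξ)]

theorem le_norm_sub_mul_I {μ : ℝ} (b : ℝ) :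
    μ ≤ ‖(μ : ℂ) - (b : ℝ) * Complex.I‖ := by
  refine le_trans ?_ (Complex.re_le_norm _)
  simp

theorem norm_lapSymbol_le (n : ℕ) {μ : ℝ} (hμ : 0 < μ) (x₀ σ ξ : ℝ) :
    ‖lapSymbol n μ x₀ σ ξ‖ ≤ n.factorial / μ ^ (n + 1) := by
  rw [norm_lapSymbol]
  gcongr
  exact le_norm_sub_mul_I _

theorem integrable_lapSymbol_mul_FT (n : ℕ) {μ : ℝ} (hμ : 0 < μ) (x₀ σ : ℝ) (u : 𝓢(ℝ, ℝ)) :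
    Integrable (fun ξ => lapSymbol n μ x₀ σ ξ * FT u ξ) :=
  (integrable_FT u).bdd_mul (continuous_lapSymbol n hμ x₀ σ).aestronglyMeasurable
    (Filter.Eventually.of_forall (norm_lapSymbol_le n hμ x₀ σ))

theorem abs_halfLap_le (n : ℕ) {μ σ ε : ℝ} (hμ : 0 < μ) (hσ : σ ^ 2 = 1) (x₀ : ℝ)
    (hε : 0 < ε) (u : 𝓢(ℝ, ℝ)) (hB : BesovNorm u ≤ ε) :
    |halfLap (n + 1) μ x₀ σ u| ≤ 15 * (n + 1).factorial * ε / μ ^ (n + 1) := by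
  rw [← Real.norm_eq_abs, ← Complex.norm_real, halfLap_eq_integral_fourier _ hμ]
  refine (norm_integral_le_of_norm_le
    ((integrable_norm_FT_div u hμ).const_mul ((n + 1).factorial / μ ^ n))
    (Filter.Eventually.of_forall fun ξ => ?_)).trans ?_
  · rw [norm_mul, norm_lapSymbol, div_mul_div_comm, div_mul_eq_mul_div]
    gcongr
    rw [show n + 1 + 1 = n + 2 by rfl, pow_add]
    gcongr
    · exact le_norm_sub_mul_I _
    · exact sq_add_sq_le_norm_sq hσ μ ξ
  · rw [integral_const_mul]
    calc _ ≤ (n + 1).factorial / μ ^ n * (15 * ε / μ) := by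
          gcongr
          exact integral_norm_FT_div_le u hε hB hμ
      _ = _ := by
          field_simp
          ring

theorem abs_halfLap_zero_add_le {μ ε : ℝ} (hμ : 0 < μ) (x₀ : ℝ)
    (hε : 0 < ε) (u : 𝓢(ℝ, ℝ)) (hB : BesovNorm u ≤ ε) :
    |halfLap 0 μ x₀ 1 u + halfLap 0 μ x₀ (-1) u| ≤ 30 * ε := by
  rw [← Real.norm_eq_abs, ← Complex.norm_real, Complex.ofReal_add, halfLap_eq_integral_fourier _ hμ,
    halfLap_eq_integral_fourier _ hμ, ← integral_add (integrable_lapSymbol_mul_FT 0 hμ x₀ 1 u)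
      (integrable_lapSymbol_mul_FT 0 hμ x₀ (-1) u)]
  refine (norm_integral_le_of_norm_le
    ((integrable_norm_FT_div u hμ).const_mul (2 * μ))
    (Filter.Eventually.of_forall fun ξ => ?_)).trans ?_
  · have h1 := sq_add_sq_le_norm_sq (σ := 1) (by norm_num) μ ξ
    have h2 := sq_add_sq_le_norm_sq (σ := -1) (by norm_num) μ ξ
    have p : 0 < μ ^ 2 + ξ ^ 2 := by positivity
    have n1 : (μ : ℂ) - (2 * π * 1 * ξ : ℝ) * Complex.I ≠ 0 := fun h => by
      rw [h] at h1; norm_num at h1; linarith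
    have n2 : (μ : ℂ) - (2 * π * (-1) * ξ : ℝ) * Complex.I ≠ 0 := fun h => by
      rw [h] at h2; norm_num at h2; linarith
    have e : lapSymbol 0 μ x₀ 1 ξ * FT u ξ + lapSymbol 0 μ x₀ (-1) ξ * FT u ξ
        = Complex.exp ((2 * π * x₀ * ξ : ℝ) * Complex.I) *
          ((2 * μ : ℝ) / (((μ : ℂ) - (2 * π * 1 * ξ : ℝ) * Complex.I) *
            ((μ : ℂ) - (2 * π * (-1) * ξ : ℝ) * Complex.I))) * FT u ξ := by
      have hs : ((2 * μ : ℝ) : ℂ) = ((μ : ℂ) - (2 * π * 1 * ξ : ℝ) * Complex.I) +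
          ((μ : ℂ) - (2 * π * (-1) * ξ : ℝ) * Complex.I) := by
        push_cast
        ring
      rw [lapSymbol, lapSymbol, hs, Nat.factorial_zero, Nat.cast_one, zero_add, pow_one, pow_one]
      generalize (μ : ℂ) - (2 * π * 1 * ξ : ℝ) * Complex.I = a at n1
      generalize (μ : ℂ) - (2 * π * (-1) * ξ : ℝ) * Complex.I = b at n2
      field_simp
      ring
    rw [e, norm_mul, norm_mul, Complex.norm_exp_ofReal_mul_I, one_mul, norm_div, Complex.norm_real,
      Real.norm_of_nonneg (by positivity), norm_mul, div_mul_eq_mul_div, mul_div_assoc']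
    gcongr
    refine le_of_sq_le_sq ?_ (by positivity)
    rw [mul_pow, sq (μ ^ 2 + ξ ^ 2)]
    gcongr
  · rw [integral_const_mul]
    calc _ ≤ 2 * μ * (15 * ε / μ) := by
          gcongr
          exact integral_norm_FT_div_le u hε hB hμ
      _ = _ := by
          field_simp
          norm_num

/-- The dimensionless majorant of `|ξ|⁻¹ |m|²` for the difference `m` of two exponential multipliers
at frequencies `μ ≤ lam`. -/
def logMajorant (μ lam r : ℝ) : ℝ :=
  (Ioc 0 μ).indicator (fun _ => μ⁻¹) r + (Ioc μ lam).indicator (fun r => r⁻¹) r +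
    (Ioi lam).indicator (fun r => lam ^ 2 * r ^ (-3:ℝ)) r

theorem integrableOn_logMajorant_and_integral_le {μ lam : ℝ} (hμ : 0 < μ) (h : μ ≤ lam) :
    IntegrableOn (logMajorant μ lam) (Ioi 0) ∧
      ∫ r in Ioi 0, logMajorant μ lam r ≤ 2 + Real.log (lam / μ) := by
  have hl : 0 < lam := hμ.trans_le h
  have i1 : Integrable ((Ioc 0 μ).indicator (fun _ => μ⁻¹)) (volume.restrict (Ioi (0:ℝ))) := by
    rw [integrable_indicator_iff measurableSet_Ioc]
    exact integrableOn_const (((Measure.restrict_apply_le _ _).trans_lt (by simp)).ne)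
  have c2 : ContinuousOn (fun r : ℝ => r⁻¹) (uIcc μ lam) := by
    rw [uIcc_of_le h]
    exact continuousOn_inv₀.mono fun r hr => (hμ.trans_le hr.1).ne'
  have i2' : IntegrableOn (fun r : ℝ => r⁻¹) (Ioc μ lam) :=
    (intervalIntegrable_iff_integrableOn_Ioc_of_le h).mp c2.intervalIntegrable
  have i2 : Integrable ((Ioc μ lam).indicator (fun r => r⁻¹)) (volume.restrict (Ioi (0:ℝ))) :=
    ((integrable_indicator_iff measurableSet_Ioc).mpr i2').restrict
  have i3' : IntegrableOn (fun r : ℝ => lam ^ 2 * r ^ (-3:ℝ)) (Ioi lam) :=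
    (integrableOn_Ioi_rpow_of_lt (by norm_num) hl).const_mul _
  have i3 : Integrable ((Ioi lam).indicator (fun r => lam ^ 2 * r ^ (-3:ℝ)))
      (volume.restrict (Ioi (0:ℝ))) :=
    ((integrable_indicator_iff measurableSet_Ioi).mpr i3').restrict
  refine ⟨(i1.add i2).add i3, ?_⟩
  have e1 : ∫ r in Ioi 0, (Ioc 0 μ).indicator (fun _ => μ⁻¹) r = 1 := by
    rw [setIntegral_indicator measurableSet_Ioc,
      inter_eq_self_of_subset_right Ioc_subset_Ioi_self, setIntegral_const,
      Real.volume_real_Ioc_of_le hμ.le, smul_eq_mul, sub_zero, mul_inv_cancel₀ hμ.ne']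
  have e2 : ∫ r in Ioi 0, (Ioc μ lam).indicator (fun r => r⁻¹) r = Real.log (lam / μ) := by
    rw [setIntegral_indicator measurableSet_Ioc,
      inter_eq_self_of_subset_right (Ioc_subset_Ioi_self.trans (Ioi_subset_Ioi hμ.le)),
      ← intervalIntegral.integral_of_le h, integral_inv_of_pos hμ hl]
  have e3 : ∫ r in Ioi 0, (Ioi lam).indicator (fun r => lam ^ 2 * r ^ (-3:ℝ)) r = 1 / 2 := by
    rw [setIntegral_indicator measurableSet_Ioi,
      inter_eq_self_of_subset_right (Ioi_subset_Ioi hl.le), integral_const_mul,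
      integral_Ioi_rpow_of_lt (by norm_num) hl, show (-3:ℝ) + 1 = -2 by norm_num,
      Real.rpow_neg hl.le]
    norm_cast
    field_simp
    norm_num
  have : ∫ r in Ioi 0, logMajorant μ lam r = 1 + Real.log (lam / μ) + 1 / 2 := by
    have h12 := integral_add i1 i2
    have h123 := integral_add (i1.add i2) i3
    simp only [Pi.add_apply] at h123
    rw [h12, e1, e2, e3] at h123
    exact h123
  linarith

/-- Difference of the multipliers of an exponential at frequency `lam` and a smooth kernel of the
same mass at frequency `μ`. -/
theorem norm_lapSymbol_sub_sq_le {μ lam σ : ℝ} (hμ : 0 < μ) (h : μ ≤ lam) (hσ : σ ^ 2 = 1)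
    (x₀ ξ : ℝ) (hξ : ξ ≠ 0) :
    ‖lapSymbol 0 lam x₀ σ ξ - (μ ^ 4 / (6 * lam) : ℝ) * lapSymbol 3 μ x₀ 1 ξ‖ ^ 2
      ≤ |ξ| * (1600 / lam ^ 2 * logMajorant μ lam |ξ|) := by
  have hl : 0 < lam := hμ.trans_le h
  have hξ' : 0 < |ξ| := abs_pos.mpr hξ
  set a : ℂ := (lam : ℂ) - (2 * π * σ * ξ : ℝ) * Complex.I with ha
  set b : ℂ := (μ : ℂ) - (2 * π * 1 * ξ : ℝ) * Complex.I with hb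
  set m := ‖lapSymbol 0 lam x₀ σ ξ - (μ ^ 4 / (6 * lam) : ℝ) * lapSymbol 3 μ x₀ 1 ξ‖ with hm
  have aξ : |ξ| ≤ ‖a‖ := by
    refine abs_le_of_sq_le_sq ?_ (norm_nonneg _)
    nlinarith [sq_add_sq_le_norm_sq hσ lam ξ]
  have bξ : |ξ| ≤ ‖b‖ := by
    refine abs_le_of_sq_le_sq ?_ (norm_nonneg _)
    nlinarith [sq_add_sq_le_norm_sq (σ := 1) (by norm_num) μ ξ]
  have al : lam ≤ ‖a‖ := le_norm_sub_mul_I _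
  have bμ : μ ≤ ‖b‖ := le_norm_sub_mul_I _
  have a0 : a ≠ 0 := norm_pos_iff.mp (hl.trans_le al)
  have b0 : b ≠ 0 := norm_pos_iff.mp (hμ.trans_le bμ)
  have lc : (lam : ℂ) ≠ 0 := by exact_mod_cast hl.ne'
  set w : ℂ := μ / b with hw
  have nw : ‖w‖ = μ / ‖b‖ := by rw [hw, norm_div, Complex.norm_real, Real.norm_of_nonneg hμ.le]
  have w1 : ‖w‖ ≤ 1 := by rw [nw]; exact div_le_one_of_le₀ bμ (norm_nonneg _)
  have w4 : ‖w ^ 4‖ ≤ ‖w‖ := by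
    rw [norm_pow]
    exact pow_le_of_le_one (norm_nonneg _) w1 (by norm_num)
  have em : m = ‖1 / a - 1 / lam * w ^ 4‖ := by
    have : lapSymbol 0 lam x₀ σ ξ - (μ ^ 4 / (6 * lam) : ℝ) * lapSymbol 3 μ x₀ 1 ξ
        = Complex.exp ((2 * π * x₀ * ξ : ℝ) * Complex.I) * (1 / a - 1 / lam * w ^ 4) := by
      rw [lapSymbol, lapSymbol, ← ha, ← hb, hw]
      norm_num [Nat.factorial]
      field_simp
    rw [hm, this, norm_mul, Complex.norm_exp_ofReal_mul_I, one_mul]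
  have nl : ‖(1:ℂ) / lam‖ = 1 / lam := by
    rw [norm_div, norm_one, Complex.norm_real, Real.norm_of_nonneg hl.le]
  have na : ‖1 / a‖ = 1 / ‖a‖ := by rw [norm_div, norm_one]
  have bound : m ≤ 1 / ‖a‖ + 1 / lam * ‖w‖ := by
    rw [em]
    refine (norm_sub_le _ _).trans ?_
    rw [norm_mul, nl, na]
    gcongr
  have m0 : 0 ≤ m := norm_nonneg _
  rw [logMajorant]
  rcases le_or_gt |ξ| μ with c1 | c1
  · rw [indicator_of_mem (show |ξ| ∈ Ioc 0 μ from ⟨hξ', c1⟩),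
      indicator_of_notMem (show |ξ| ∉ Ioc μ lam from fun hh => absurd hh.1 (not_lt.mpr c1)),
      indicator_of_notMem (show |ξ| ∉ Ioi lam from not_lt.mpr (c1.trans h)), add_zero, add_zero]
    have e1 : ‖1 / a - 1 / lam‖ ≤ 1 / lam * (2 * π * |ξ| / μ) := by
      have : 1 / a - 1 / lam = 1 / lam * (((2 * π * σ * ξ : ℝ) * Complex.I) / a) := by
        have : (2 * π * σ * ξ : ℝ) * Complex.I = lam - a := by rw [ha]; ring
        rw [this]
        field_simp
      have s1 : |σ| = 1 := by
        rw [← sq_eq_sq₀ (abs_nonneg _) one_pos.le, sq_abs, hσ, one_pow]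
      rw [this, norm_mul, nl, norm_div, norm_mul, Complex.norm_I, Complex.norm_real, mul_one,
        Real.norm_eq_abs, abs_mul, abs_mul, s1, mul_one, abs_of_pos Real.two_pi_pos]
      gcongr
      exact h.trans al
    have e2 : ‖1 - w‖ ≤ 2 * π * |ξ| / μ := by
      have : 1 - w = -(((2 * π * ξ : ℝ) * Complex.I) / b) := by
        have : (2 * π * ξ : ℝ) * Complex.I = μ - b := by rw [hb]; push_cast; ring
        rw [this, hw]
        field_simp
        ring
      rw [this, norm_neg, norm_div, norm_mul, Complex.norm_I, Complex.norm_real, mul_one,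
        Real.norm_eq_abs, abs_mul, abs_of_pos Real.two_pi_pos]
      gcongr
    have e3 : ‖1 - w ^ 4‖ ≤ 4 * (2 * π * |ξ| / μ) := by
      have : 1 - w ^ 4 = (1 + w + w ^ 2 + w ^ 3) * (1 - w) := by ring
      rw [this, norm_mul]
      have t : ‖1 + w + w ^ 2 + w ^ 3‖ ≤ 4 := by
        have h2 : ‖w ^ 2‖ ≤ 1 := by rw [norm_pow]; exact pow_le_one₀ (norm_nonneg _) w1
        have h3 : ‖w ^ 3‖ ≤ 1 := by rw [norm_pow]; exact pow_le_one₀ (norm_nonneg _) w1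
        have := norm_add₃_le (a := 1 + w) (b := w ^ 2) (c := w ^ 3)
        have := norm_add_le (1:ℂ) w
        rw [norm_one] at this
        linarith
      gcongr
    have e4 : m ≤ 40 * |ξ| / (lam * μ) := by
      have : 1 / a - 1 / lam * w ^ 4 = (1 / a - 1 / lam) + 1 / lam * (1 - w ^ 4) := by ring
      rw [em, this]
      refine (norm_add_le _ _).trans ?_
      rw [norm_mul, nl]
      calc _ ≤ 1 / lam * (2 * π * |ξ| / μ) + 1 / lam * (4 * (2 * π * |ξ| / μ)) := by gcongr
        _ = (10 * π) * |ξ| / (lam * μ) := by field_simp; ring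
        _ ≤ _ := by
          gcongr
          linarith [Real.pi_lt_four]
    calc m ^ 2 ≤ (40 * |ξ| / (lam * μ)) ^ 2 := by gcongr
      _ = |ξ| * (1600 / lam ^ 2 * (|ξ| / μ * μ⁻¹)) := by
        field_simp
        norm_num
      _ ≤ |ξ| * (1600 / lam ^ 2 * (1 * μ⁻¹)) := by
        gcongr
        exact div_le_one_of_le₀ c1 hμ.le
      _ = _ := by rw [one_mul]
  rcases le_or_gt |ξ| lam with c2 | c2
  · rw [indicator_of_notMem (show |ξ| ∉ Ioc 0 μ from fun hh => absurd hh.2 (not_le.mpr c1)),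
      indicator_of_mem (show |ξ| ∈ Ioc μ lam from ⟨c1, c2⟩),
      indicator_of_notMem (show |ξ| ∉ Ioi lam from not_lt.mpr c2), zero_add, add_zero]
    have e4 : m ≤ 2 / lam := by
      refine bound.trans ?_
      calc _ ≤ 1 / lam + 1 / lam * 1 := by gcongr
        _ = _ := by ring
    calc m ^ 2 ≤ (2 / lam) ^ 2 := by gcongr
      _ = 4 / lam ^ 2 := by ring
      _ ≤ 1600 / lam ^ 2 := by gcongr; norm_num
      _ = _ := by field_simp
  · rw [indicator_of_notMem (show |ξ| ∉ Ioc 0 μ from fun hh => absurd hh.2 (not_le.mpr c1)),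
      indicator_of_notMem (show |ξ| ∉ Ioc μ lam from fun hh => absurd hh.2 (not_le.mpr c2)),
      indicator_of_mem (show |ξ| ∈ Ioi lam from c2), zero_add, zero_add]
    have e4 : m ≤ 2 / |ξ| := by
      refine bound.trans ?_
      rw [nw]
      calc 1 / ‖a‖ + 1 / lam * (μ / ‖b‖) ≤ 1 / |ξ| + 1 / lam * (lam / |ξ|) := by gcongr
        _ = _ := by field_simp; norm_num
    calc m ^ 2 ≤ (2 / |ξ|) ^ 2 := by gcongr
      _ = 4 / |ξ| ^ 2 := by ring
      _ ≤ 1600 / |ξ| ^ 2 := by gcongr; norm_num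
      _ = _ := by
        rw [Real.rpow_neg hξ'.le]
        norm_cast
        field_simp

theorem integrable_abs_mul_norm_FT_sq (f : 𝓢(ℝ, ℝ)) :
    Integrable (fun ξ : ℝ => |ξ| * ‖FT f ξ‖ ^ 2) := by
  obtain ⟨K, hK0, hK⟩ := exists_norm_FT_le f
  have h := ((𝓕 (complexify f)).integrable_pow_mul volume 1).mul_const K
  refine h.mono' ?_ (Filter.Eventually.of_forall fun ξ => ?_)
  · exact (continuous_abs.mul ((continuous_FT f).norm.pow 2)).aestronglyMeasurable
  · rw [Real.norm_of_nonneg (by positivity), sq, ← mul_assoc, pow_one, Real.norm_eq_abs,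
      ← FT_apply]
    gcongr
    exact hK ξ

theorem integral_abs_mul_norm_FT_sq_le {f : 𝓢(ℝ, ℝ)} {ε : ℝ}
    (hH : HsNorm (1 / 2) f ≤ ε) : ∫ ξ : ℝ, |ξ| * ‖FT f ξ‖ ^ 2 ≤ ε ^ 2 := by
  have h0 : 0 ≤ ∫ ξ : ℝ, |ξ| * ‖FT f ξ‖ ^ 2 := integral_nonneg fun ξ => by positivity
  rw [HsNorm, show (2:ℝ) * (1 / 2) = 1 by norm_num] at hH
  simp only [Real.rpow_one] at hH
  rw [← Real.sqrt_eq_rpow] at hH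
  exact (Real.sqrt_le_left ((Real.sqrt_nonneg _).trans hH)).mp hH

theorem integrable_comp_abs {g : ℝ → ℝ} (hg : IntegrableOn g (Ioi 0)) :
    Integrable (fun ξ => g |ξ|) := by
  have h1 : IntegrableOn (fun ξ => g |ξ|) (Ioi 0) :=
    hg.congr_fun (fun x hx => by rw [abs_of_pos hx]) measurableSet_Ioi
  have h2 : IntegrableOn (fun ξ => g |ξ|) (Iic 0) := by
    have m : MeasurableEmbedding fun x : ℝ => -x := (Homeomorph.neg ℝ).measurableEmbedding
    rw [← Measure.map_neg_eq_self (volume : Measure ℝ), m.integrableOn_map_iff]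
    simpa [Function.comp_def, integrableOn_Ici_iff_integrableOn_Ioi] using h1
  rw [← integrableOn_univ, ← Iic_union_Ioi (a := (0:ℝ))]
  exact h2.union h1

/-- A Schwartz function in `Ḣ^{1/2}` has averages on scales `lam⁻¹ ≤ μ⁻¹` that differ by at most a
logarithm. -/
theorem abs_halfLap_sub_le {μ lam σ ε : ℝ} (hμ : 0 < μ) (h : μ ≤ lam) (hσ : σ ^ 2 = 1) (x₀ : ℝ)
    (hε : 0 < ε) (f : 𝓢(ℝ, ℝ)) (hH : HsNorm (1 / 2) f ≤ ε) :
    |halfLap 0 lam x₀ σ f - μ ^ 4 / (6 * lam) * halfLap 3 μ x₀ 1 f|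
      ≤ 4000 * ε / lam * (1 + Real.log (lam / μ)) := by
  have hl : 0 < lam := hμ.trans_le h
  obtain ⟨iM, bM⟩ := integrableOn_logMajorant_and_integral_le hμ h
  have iM' : Integrable (fun ξ : ℝ => logMajorant μ lam |ξ|) := integrable_comp_abs iM
  have bM' : ∫ ξ : ℝ, logMajorant μ lam |ξ| ≤ 2 * (2 + Real.log (lam / μ)) := by
    rw [integral_comp_abs]
    gcongr
  have hlog : 0 ≤ Real.log (lam / μ) := Real.log_nonneg (by rwa [le_div_iff₀ hμ, one_mul])
  rw [← Real.norm_eq_abs, ← Complex.norm_real, Complex.ofReal_sub, Complex.ofReal_mul,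
    halfLap_eq_integral_fourier _ hl, halfLap_eq_integral_fourier _ hμ, ← integral_const_mul,
    ← integral_sub (integrable_lapSymbol_mul_FT 0 hl x₀ σ f)
      ((integrable_lapSymbol_mul_FT 3 hμ x₀ 1 f).const_mul _)]
  refine (norm_integral_le_of_norm_le
    (((integrable_abs_mul_norm_FT_sq f).const_mul (1 / (2 * ε * lam))).add
      (iM'.const_mul (ε * lam / 2 * (1600 / lam ^ 2)))) ?_).trans ?_
  · filter_upwards [compl_mem_ae_iff.mpr (measure_singleton (0:ℝ))] with ξ hξ
    have hξ' : 0 < |ξ| := abs_pos.mpr hξ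
    have hm := norm_lapSymbol_sub_sq_le hμ h hσ x₀ ξ hξ
    rw [← mul_assoc, ← sub_mul, norm_mul]
    set m := ‖lapSymbol 0 lam x₀ σ ξ - (μ ^ 4 / (6 * lam) : ℝ) * lapSymbol 3 μ x₀ 1 ξ‖
    set F := ‖FT f ξ‖
    have k : 0 ≤ (|ξ| * F - ε * lam * m) ^ 2 := sq_nonneg _
    have k2 : m * F ≤ 1 / (2 * ε * lam) * (|ξ| * F ^ 2) + ε * lam / 2 * (m ^ 2 / |ξ|) := by
      rw [← sub_nonneg]
      have : 1 / (2 * ε * lam) * (|ξ| * F ^ 2) + ε * lam / 2 * (m ^ 2 / |ξ|) - m * F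
          = (|ξ| * F - ε * lam * m) ^ 2 / (2 * ε * lam * |ξ|) := by
        field_simp
        ring
      rw [this]
      positivity
    refine k2.trans ?_
    simp only [Pi.add_apply]
    rw [mul_assoc (ε * lam / 2)]
    gcongr
    rwa [div_le_iff₀' hξ']
  · simp only [Pi.add_apply]
    rw [integral_add ((integrable_abs_mul_norm_FT_sq f).const_mul _) (iM'.const_mul _),
      integral_const_mul, integral_const_mul]
    calc _ ≤ 1 / (2 * ε * lam) * ε ^ 2
          + ε * lam / 2 * (1600 / lam ^ 2) * (2 * (2 + Real.log (lam / μ))) := by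
          gcongr
          exact integral_abs_mul_norm_FT_sq_le hH
      _ = ε / lam * (3200 + 1 / 2 + 1600 * Real.log (lam / μ)) := by
          field_simp
          ring
      _ ≤ ε / lam * (4000 * (1 + Real.log (lam / μ))) := by
          gcongr
          linarith
      _ = _ := by ring

theorem integrableOn_halfLap (n : ℕ) {μ K : ℝ} (hμ : 0 < μ) (x₀ σ : ℝ) {g : ℝ → ℝ}
    (hc : Continuous g) (hb : ∀ y, |g y| ≤ K) :
    IntegrableOn (fun s => s ^ n * Real.exp (-(μ * s)) * g (x₀ + σ * s)) (Ioi 0) :=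
  (integrableOn_pow_mul_exp_neg n hμ).mul_bdd (c := K)
    (hc.comp (by fun_prop)).aestronglyMeasurable (Filter.Eventually.of_forall fun s => hb _)

theorem integral_pow_mul_exp_neg (n : ℕ) {μ : ℝ} (hμ : 0 < μ) :
    ∫ s in Ioi (0:ℝ), s ^ n * Real.exp (-(μ * s)) = n.factorial / μ ^ (n + 1) := by
  have h := integral_pow_mul_cexp_neg n (w := (μ : ℂ)) (by simpa using hμ)
  apply Complex.ofReal_injective
  rw [← integral_complex_ofReal]
  push_cast
  exact h

theorem abs_halfLap_le_of_abs_le (n : ℕ) {μ a b x₀ σ : ℝ} (hμ : 0 < μ) {g : ℝ → ℝ}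
    (hg : ∀ s, 0 < s → |g (x₀ + σ * s)| ≤ a + b * s) :
    |halfLap n μ x₀ σ g|
      ≤ a * (n.factorial / μ ^ (n + 1)) + b * ((n + 1).factorial / μ ^ (n + 2)) := by
  have i1 := (integrableOn_pow_mul_exp_neg n hμ).const_mul a
  have i2 := (integrableOn_pow_mul_exp_neg (n + 1) hμ).const_mul b
  have h := norm_integral_le_of_norm_le (i1.add i2)
    (f := fun s => s ^ n * Real.exp (-(μ * s)) * g (x₀ + σ * s))
    ((ae_restrict_iff' measurableSet_Ioi).mpr (Filter.Eventually.of_forall fun s hs => by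
      have hs' : 0 < s := hs
      rw [Real.norm_eq_abs, abs_mul, abs_of_pos (by positivity)]
      calc _ ≤ s ^ n * Real.exp (-(μ * s)) * (a + b * s) := by
            gcongr
            exact hg s hs
        _ = _ := by
            simp only [Pi.add_apply]
            ring))
  simp only [Pi.add_apply] at h
  rw [integral_add i1 i2, integral_const_mul, integral_const_mul, integral_pow_mul_exp_neg _ hμ,
    integral_pow_mul_exp_neg _ hμ] at h
  exact h

theorem tendsto_halfLap_boundary (n : ℕ) {μ K : ℝ} (hμ : 0 < μ) (x₀ σ : ℝ) {g : ℝ → ℝ}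
    (hb : ∀ y, |g y| ≤ K) :
    Filter.Tendsto (fun s => s ^ n * Real.exp (-(μ * s)) * g (x₀ + σ * s)) Filter.atTop
      (nhds 0) := by
  have h := (tendsto_pow_mul_exp_neg n hμ).zero_mul_isBoundedUnder_le
    (g := fun s => g (x₀ + σ * s))
    (Filter.isBoundedUnder_of ⟨K, fun s => hb (x₀ + σ * s)⟩)
  exact h

theorem halfLap_zero_deriv {μ K : ℝ} (hμ : 0 < μ) (x₀ σ : ℝ) {g g' : ℝ → ℝ}
    (hg : ∀ y, HasDerivAt g (g' y) y) (hc : Continuous g') (hb : ∀ y, |g y| ≤ K)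
    (hb' : ∀ y, |g' y| ≤ K) :
    σ * halfLap 0 μ x₀ σ g' = μ * halfLap 0 μ x₀ σ g - g x₀ := by
  have hgc : Continuous g := continuous_iff_continuousAt.mpr fun y => (hg y).continuousAt
  have i0 := (integrableOn_halfLap 0 hμ x₀ σ hgc hb).const_mul μ
  have i1 := (integrableOn_halfLap 0 hμ x₀ σ hc hb').const_mul σ
  have hd : ∀ s : ℝ, HasDerivAt (fun s => Real.exp (-(μ * s)) * g (x₀ + σ * s))
      (σ * (s ^ 0 * Real.exp (-(μ * s)) * g' (x₀ + σ * s))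
        - μ * (s ^ 0 * Real.exp (-(μ * s)) * g (x₀ + σ * s))) s := fun s => by
    have h1 : HasDerivAt (fun s => Real.exp (-(μ * s))) (Real.exp (-(μ * s)) * (-(μ * 1))) s :=
      ((hasDerivAt_id s).const_mul μ).neg.exp
    have h2 : HasDerivAt (fun s => g (x₀ + σ * s)) (g' (x₀ + σ * s) * (σ * 1)) s :=
      (hg _).comp s (((hasDerivAt_id s).const_mul σ).const_add x₀)
    exact (h1.mul h2).congr_deriv (by ring)
  have ht := tendsto_halfLap_boundary 0 hμ x₀ σ hb
  simp only [pow_zero, one_mul] at ht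
  have h := integral_Ioi_of_hasDerivAt_of_tendsto' (fun s _ => hd s) (i1.sub i0) ht
  rw [integral_sub i1 i0, integral_const_mul, integral_const_mul] at h
  simp only [mul_zero, neg_zero, Real.exp_zero, add_zero, one_mul, zero_sub] at h
  rw [halfLap, halfLap]
  linarith

theorem halfLap_succ_deriv (n : ℕ) {μ K : ℝ} (hμ : 0 < μ) (x₀ σ : ℝ) {g g' : ℝ → ℝ}
    (hg : ∀ y, HasDerivAt g (g' y) y) (hc : Continuous g') (hb : ∀ y, |g y| ≤ K)
    (hb' : ∀ y, |g' y| ≤ K) :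
    σ * halfLap (n + 1) μ x₀ σ g'
      = μ * halfLap (n + 1) μ x₀ σ g - (n + 1) * halfLap n μ x₀ σ g := by
  have hgc : Continuous g := continuous_iff_continuousAt.mpr fun y => (hg y).continuousAt
  have i0 := (integrableOn_halfLap (n + 1) hμ x₀ σ hgc hb).const_mul μ
  have i1 := (integrableOn_halfLap (n + 1) hμ x₀ σ hc hb').const_mul σ
  have i2 := (integrableOn_halfLap n hμ x₀ σ hgc hb).const_mul ((n : ℝ) + 1)
  have hd : ∀ s : ℝ, HasDerivAt (fun s => s ^ (n + 1) * Real.exp (-(μ * s)) * g (x₀ + σ * s))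
      (σ * (s ^ (n + 1) * Real.exp (-(μ * s)) * g' (x₀ + σ * s))
        - μ * (s ^ (n + 1) * Real.exp (-(μ * s)) * g (x₀ + σ * s))
        + (n + 1) * (s ^ n * Real.exp (-(μ * s)) * g (x₀ + σ * s))) s := fun s => by
    have h0 : HasDerivAt (fun s : ℝ => s ^ (n + 1)) ((n + 1) * s ^ n) s := by
      simpa using hasDerivAt_pow (n + 1) s
    have h1 : HasDerivAt (fun s => Real.exp (-(μ * s))) (Real.exp (-(μ * s)) * (-(μ * 1))) s :=
      ((hasDerivAt_id s).const_mul μ).neg.exp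
    have h2 : HasDerivAt (fun s => g (x₀ + σ * s)) (g' (x₀ + σ * s) * (σ * 1)) s :=
      (hg _).comp s (((hasDerivAt_id s).const_mul σ).const_add x₀)
    exact ((h0.mul h1).mul h2).congr_deriv (by simp only [Pi.mul_apply]; ring)
  have h := integral_Ioi_of_hasDerivAt_of_tendsto' (fun s _ => hd s) ((i1.sub i0).add i2)
    (tendsto_halfLap_boundary (n + 1) hμ x₀ σ hb)
  have e := integral_add (i1.sub i0) i2
  simp only [Pi.sub_apply] at e h
  rw [e, integral_sub i1 i0, integral_const_mul, integral_const_mul, integral_const_mul] at h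
  simp only [zero_pow (Nat.succ_ne_zero n), zero_mul, sub_zero] at h
  rw [halfLap, halfLap, halfLap]
  linarith

theorem halfLap_nonlinear (n : ℕ) {μ K : ℝ} (hμ : 0 < μ) (x₀ σ : ℝ) {u u₂ : ℝ → ℝ}
    (hu : Continuous u) (hu₂ : Continuous u₂) (hb : ∀ y, |u y| ≤ K) (hb₂ : ∀ y, |u₂ y| ≤ K) :
    halfLap n μ x₀ σ (fun y => y * u y - 3 * u₂ y + 9 * u y ^ 2)
      = x₀ * halfLap n μ x₀ σ u + σ * halfLap (n + 1) μ x₀ σ u - 3 * halfLap n μ x₀ σ u₂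
        + 9 * halfLap n μ x₀ σ (fun y => u y ^ 2) := by
  have hbq : ∀ y, |u y ^ 2| ≤ K ^ 2 := fun y => by
    rw [abs_pow]
    exact pow_le_pow_left₀ (abs_nonneg _) (hb y) 2
  have i0 := (integrableOn_halfLap n hμ x₀ σ hu hb).const_mul x₀
  have i1 := (integrableOn_halfLap (n + 1) hμ x₀ σ hu hb).const_mul σ
  have i2 := (integrableOn_halfLap n hμ x₀ σ hu₂ hb₂).const_mul 3
  have i3 := (integrableOn_halfLap n hμ x₀ σ (hu.pow 2) hbq).const_mul 9
  have e0 := integral_add i0 i1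
  have e1 := integral_sub (i0.add i1) i2
  have e2 := integral_add ((i0.add i1).sub i2) i3
  simp only [Pi.add_apply, Pi.sub_apply, Pi.pow_apply] at e0 e1 e2
  rw [e1, e0, integral_const_mul, integral_const_mul, integral_const_mul, integral_const_mul] at e2
  simp only [halfLap]
  rw [← e2]
  refine integral_congr_ae (Filter.Eventually.of_forall fun s => ?_)
  simp only
  ring

/-- Averaged form, at time `1`, of the Besov bound on `u` and of the `Ḣ^{1/2}` bound on
`y u - 3 u'' + 9 u²`. -/
structure EllipticBounds (ε K : ℝ) (u u₁ u₂ : ℝ → ℝ) : Prop where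
  hasDerivAt : ∀ y, HasDerivAt u (u₁ y) y
  hasDerivAt₁ : ∀ y, HasDerivAt u₁ (u₂ y) y
  continuous₂ : Continuous u₂
  bound : ∀ y, |u y| ≤ K
  bound₁ : ∀ y, |u₁ y| ≤ K
  bound₂ : ∀ y, |u₂ y| ≤ K
  small : ∀ y, |u y| ≤ 1 / 32
  avg : ∀ (n : ℕ) (μ σ x₀ : ℝ), 0 < μ → σ ^ 2 = 1 →
    |halfLap (n + 1) μ x₀ σ u| ≤ 15 * (n + 1).factorial * ε / μ ^ (n + 1)
  avg_zero : ∀ μ x₀ : ℝ, 0 < μ → |halfLap 0 μ x₀ 1 u + halfLap 0 μ x₀ (-1) u| ≤ 30 * ε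
  avg_sub : ∀ μ lam σ x₀ : ℝ, 0 < μ → μ ≤ lam → σ ^ 2 = 1 →
    |halfLap 0 lam x₀ σ (fun y => y * u y - 3 * u₂ y + 9 * u y ^ 2) - μ ^ 4 / (6 * lam) *
      halfLap 3 μ x₀ 1 (fun y => y * u y - 3 * u₂ y + 9 * u y ^ 2)|
        ≤ 4000 * ε / lam * (1 + Real.log (lam / μ))

/-- The weight measuring the admissible growth in the oscillatory region. -/
def growthWeight (y : ℝ) : ℝ := 1 + max (-y) 0

theorem one_le_growthWeight (y : ℝ) : 1 ≤ growthWeight y := by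
  have := le_max_right (-y) 0
  rw [growthWeight]
  linarith

theorem growthWeight_add_le {y s : ℝ} (hs : 0 ≤ s) : growthWeight (y + s) ≤ growthWeight y := by
  rw [growthWeight, growthWeight]
  gcongr
  linarith

theorem growthWeight_sub_le {y s : ℝ} (hs : 0 ≤ s) :
    growthWeight (y - s) ≤ growthWeight y + s := by
  rw [growthWeight, growthWeight, add_assoc]
  gcongr
  refine max_le ?_ ?_
  · linarith [le_max_left (-y) 0]
  · linarith [le_max_right (-y) 0]

namespace EllipticBounds

variable {ε K : ℝ} {u u₁ u₂ : ℝ → ℝ}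

theorem continuous (H : EllipticBounds ε K u u₁ u₂) : Continuous u :=
  continuous_iff_continuousAt.mpr fun y => (H.hasDerivAt y).continuousAt

theorem continuous₁ (H : EllipticBounds ε K u u₁ u₂) : Continuous u₁ :=
  continuous_iff_continuousAt.mpr fun y => (H.hasDerivAt₁ y).continuousAt

theorem identity_zero (H : EllipticBounds ε K u u₁ u₂) {lam σ : ℝ} (hl : 0 < lam)
    (hσ : σ ^ 2 = 1) (x₀ : ℝ) :
    3 * (lam * u x₀ + σ * u₁ x₀)
      = halfLap 0 lam x₀ σ (fun y => y * u y - 3 * u₂ y + 9 * u y ^ 2)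
        - (x₀ - 3 * lam ^ 2) * halfLap 0 lam x₀ σ u - σ * halfLap 1 lam x₀ σ u
        - 9 * halfLap 0 lam x₀ σ (fun y => u y ^ 2) := by
  have h := halfLap_nonlinear 0 hl x₀ σ H.continuous H.continuous₂ H.bound H.bound₂
  have d1 := halfLap_zero_deriv hl x₀ σ H.hasDerivAt H.continuous₁ H.bound H.bound₁
  have d2 := halfLap_zero_deriv hl x₀ σ H.hasDerivAt₁ H.continuous₂ H.bound₁ H.bound₂
  have e : halfLap 0 lam x₀ σ u₂
      = lam ^ 2 * halfLap 0 lam x₀ σ u - (lam * u x₀ + σ * u₁ x₀) := by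
    linear_combination (lam : ℝ) * d1 + σ * d2 - halfLap 0 lam x₀ σ u₂ * hσ
  rw [h, e]
  ring

theorem identity_three (H : EllipticBounds ε K u u₁ u₂) {μ : ℝ} (hμ : 0 < μ) (x₀ : ℝ) :
    halfLap 3 μ x₀ 1 (fun y => y * u y - 3 * u₂ y + 9 * u y ^ 2)
      = x₀ * halfLap 3 μ x₀ 1 u + halfLap 4 μ x₀ 1 u - 18 * halfLap 1 μ x₀ 1 u
        + 18 * μ * halfLap 2 μ x₀ 1 u - 3 * μ ^ 2 * halfLap 3 μ x₀ 1 u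
        + 9 * halfLap 3 μ x₀ 1 (fun y => u y ^ 2) := by
  have h := halfLap_nonlinear 3 hμ x₀ 1 H.continuous H.continuous₂ H.bound H.bound₂
  have d1 := halfLap_succ_deriv 2 hμ x₀ 1 H.hasDerivAt H.continuous₁ H.bound H.bound₁
  have d1' := halfLap_succ_deriv 1 hμ x₀ 1 H.hasDerivAt H.continuous₁ H.bound H.bound₁
  have d2 := halfLap_succ_deriv 2 hμ x₀ 1 H.hasDerivAt₁ H.continuous₂ H.bound₁ H.bound₂
  norm_num at h d1 d1' d2
  rw [h, d2, d1, d1']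
  ring

theorem sq_le (H : EllipticBounds ε K u u₁ u₂) {N : ℝ} (hN : ∀ y, |u y| ≤ N * growthWeight y)
    (y : ℝ) : |u y ^ 2| ≤ N / 32 * growthWeight y := by
  rw [abs_pow, sq]
  calc |u y| * |u y| ≤ (1 / 32) * (N * growthWeight y) :=
        mul_le_mul (H.small y) (hN y) (abs_nonneg _) (by norm_num)
    _ = _ := by ring

theorem abs_halfLap_zero_sq_le (H : EllipticBounds ε K u u₁ u₂) {N : ℝ} (hN0 : 0 ≤ N)
    (hN : ∀ y, |u y| ≤ N * growthWeight y) {lam σ : ℝ} (hl : 0 < lam) (hσ : σ = 1 ∨ σ = -1)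
    (x₀ : ℝ) :
    |halfLap 0 lam x₀ σ (fun y => u y ^ 2)|
      ≤ N / 32 * (growthWeight x₀ / lam + 1 / lam ^ 2) := by
  refine (abs_halfLap_le_of_abs_le 0 (a := N / 32 * growthWeight x₀) (b := N / 32) hl
    fun s hs => ?_).trans (le_of_eq ?_)
  · refine (H.sq_le hN _).trans ?_
    rw [← mul_add]
    gcongr
    rcases hσ with rfl | rfl
    · rw [one_mul]
      linarith [growthWeight_add_le (y := x₀) hs.le]
    · rw [neg_one_mul, ← sub_eq_add_neg]
      exact growthWeight_sub_le hs.le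
  · norm_num
    ring

theorem abs_halfLap_three_sq_le (H : EllipticBounds ε K u u₁ u₂) {N : ℝ} (hN0 : 0 ≤ N)
    (hN : ∀ y, |u y| ≤ N * growthWeight y) {μ : ℝ} (hμ : 0 < μ) (x₀ : ℝ) :
    |halfLap 3 μ x₀ 1 (fun y => u y ^ 2)| ≤ N / 32 * growthWeight x₀ * (6 / μ ^ 4) := by
  refine (abs_halfLap_le_of_abs_le 3 (a := N / 32 * growthWeight x₀) (b := 0) hμ
    fun s hs => ?_).trans (le_of_eq ?_)
  · refine (H.sq_le hN _).trans ?_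
    rw [zero_mul, add_zero, one_mul]
    gcongr
    exact growthWeight_add_le hs.le
  · norm_num [Nat.factorial]

theorem abs_halfLap_three_le (H : EllipticBounds ε K u u₁ u₂) {N : ℝ} (hN0 : 0 ≤ N)
    (hN : ∀ y, |u y| ≤ N * growthWeight y) {μ : ℝ} (hμ : 0 < μ) (x₀ : ℝ) :
    μ ^ 4 / 6 * |halfLap 3 μ x₀ 1 (fun y => y * u y - 3 * u₂ y + 9 * u y ^ 2)|
      ≤ ε * (15 * |x₀| * μ + 60 + 180 * μ ^ 3) + 9 * (N / 32) * growthWeight x₀ := by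
  have a1 := H.avg 0 μ 1 x₀ hμ (by norm_num)
  have a2 := H.avg 1 μ 1 x₀ hμ (by norm_num)
  have a3 := H.avg 2 μ 1 x₀ hμ (by norm_num)
  have a4 := H.avg 3 μ 1 x₀ hμ (by norm_num)
  have q := H.abs_halfLap_three_sq_le hN0 hN hμ x₀
  norm_num [Nat.factorial] at a1 a2 a3 a4
  rw [H.identity_three hμ]
  set I1 := halfLap 1 μ x₀ 1 u
  set I2 := halfLap 2 μ x₀ 1 u
  set I3 := halfLap 3 μ x₀ 1 u
  set I4 := halfLap 4 μ x₀ 1 u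
  set Q := halfLap 3 μ x₀ 1 (fun y => u y ^ 2)
  have t : |x₀ * I3 + I4 - 18 * I1 + 18 * μ * I2 - 3 * μ ^ 2 * I3 + 9 * Q|
      ≤ |x₀| * |I3| + |I4| + 18 * |I1| + 18 * μ * |I2| + 3 * μ ^ 2 * |I3| + 9 * |Q| := by
    have e1 : |18 * I1| = 18 * |I1| := by rw [abs_mul]; norm_num
    have e2 : |18 * μ * I2| = 18 * μ * |I2| := by rw [abs_mul, abs_of_pos (by positivity)]
    have e3 : |3 * μ ^ 2 * I3| = 3 * μ ^ 2 * |I3| := by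
      rw [abs_mul, abs_of_pos (by positivity)]
    have e4 : |9 * Q| = 9 * |Q| := by rw [abs_mul]; norm_num
    rw [← abs_mul x₀, ← e1, ← e2, ← e3, ← e4]
    refine (abs_add_le _ _).trans (add_le_add_left ?_ _)
    refine (abs_sub _ _).trans (add_le_add_left ?_ _)
    refine (abs_add_le _ _).trans (add_le_add_left ?_ _)
    refine (abs_sub _ _).trans (add_le_add_left ?_ _)
    exact abs_add_le _ _
  calc _ ≤ μ ^ 4 / 6 * (|x₀| * |I3| + |I4| + 18 * |I1| + 18 * μ * |I2| + 3 * μ ^ 2 * |I3|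
        + 9 * |Q|) := by gcongr
    _ ≤ μ ^ 4 / 6 * (|x₀| * (90 * ε / μ ^ 3) + 360 * ε / μ ^ 4 + 18 * (15 * ε / μ)
        + 18 * μ * (30 * ε / μ ^ 2) + 3 * μ ^ 2 * (90 * ε / μ ^ 3)
        + 9 * (N / 32 * growthWeight x₀ * (6 / μ ^ 4))) := by gcongr
    _ = _ := by
      field_simp
      ring

theorem abs_halfLap_zero_le (H : EllipticBounds ε K u u₁ u₂) {N : ℝ} (hN0 : 0 ≤ N)
    (hN : ∀ y, |u y| ≤ N * growthWeight y) {μ lam σ : ℝ} (hμ : 0 < μ) (h : μ ≤ lam)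
    (hσ : σ ^ 2 = 1) (x₀ : ℝ) :
    lam * |halfLap 0 lam x₀ σ (fun y => y * u y - 3 * u₂ y + 9 * u y ^ 2)|
      ≤ 4000 * ε * (1 + Real.log (lam / μ)) + ε * (15 * |x₀| * μ + 60 + 180 * μ ^ 3)
        + 9 * (N / 32) * growthWeight x₀ := by
  have hl : 0 < lam := hμ.trans_le h
  have h0 := H.avg_sub μ lam σ x₀ hμ h hσ
  have h3 := H.abs_halfLap_three_le hN0 hN hμ x₀
  set f := fun y => y * u y - 3 * u₂ y + 9 * u y ^ 2
  have e : |μ ^ 4 / (6 * lam) * halfLap 3 μ x₀ 1 f| = μ ^ 4 / 6 * |halfLap 3 μ x₀ 1 f| / lam := by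
    rw [abs_mul, abs_of_pos (by positivity)]
    field_simp
  have t := abs_sub_abs_le_abs_sub (halfLap 0 lam x₀ σ f) (μ ^ 4 / (6 * lam) * halfLap 3 μ x₀ 1 f)
  rw [e] at t
  calc _ ≤ lam * (4000 * ε / lam * (1 + Real.log (lam / μ))
        + μ ^ 4 / 6 * |halfLap 3 μ x₀ 1 f| / lam) := by
        gcongr
        linarith
    _ = 4000 * ε * (1 + Real.log (lam / μ)) + μ ^ 4 / 6 * |halfLap 3 μ x₀ 1 f| := by
        field_simp
    _ ≤ _ := by linarith

/-- The estimate in the elliptic region in terms of a global weighted bound. -/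
theorem elliptic_le (H : EllipticBounds ε K u u₁ u₂) (hε : 0 < ε) {N : ℝ} (hN0 : 0 ≤ N)
    (hN : ∀ y, |u y| ≤ N * growthWeight y) {x : ℝ} (hx : 2 ≤ x) :
    x * |u x| ≤ 8000 * ε * (1 + Real.log x) + N ∧
      √x * |u₁ x| ≤ 8000 * ε * (1 + Real.log x) + N := by
  have hx0 : 0 < x := by linarith
  set lam := √(x / 3) with hlam
  have l2 : lam ^ 2 = x / 3 := Real.sq_sqrt (by positivity)
  have hl : 0 < lam := Real.sqrt_pos.mpr (by positivity)
  have hl1 : 2 / 3 ≤ lam := Real.le_sqrt_of_sq_le (by linarith)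
  have hlx : lam ≤ x := Real.sqrt_le_iff.mpr ⟨hx0.le, by nlinarith⟩
  have hμ : 0 < x⁻¹ := by positivity
  have hμ2 : x⁻¹ ≤ 1 / 2 := by
    rw [one_div]
    gcongr
  have hμl : x⁻¹ ≤ lam := by linarith
  have hw : growthWeight x = 1 := by rw [growthWeight, max_eq_right (by linarith), add_zero]
  have hlogx : 0 ≤ Real.log x := Real.log_nonneg (by linarith)
  have hlog : Real.log (lam / x⁻¹) ≤ 2 * Real.log x := by
    rw [div_inv_eq_mul, Real.log_mul hl.ne' hx0.ne']
    linarith [Real.log_le_log hl hlx]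
  have key : ∀ σ : ℝ, σ = 1 ∨ σ = -1 →
      3 * lam * |lam * u x + σ * u₁ x| ≤ 8000 * ε * (1 + Real.log x) + N := fun σ hσ => by
    have hσ2 : σ ^ 2 = 1 := by rcases hσ with rfl | rfl <;> norm_num
    have hσa : |σ| = 1 := by rcases hσ with rfl | rfl <;> norm_num
    have id0 := H.identity_zero hl hσ2 x
    have b0 := H.abs_halfLap_zero_le hN0 hN hμ hμl hσ2 x
    have b1 := H.avg 0 lam σ x hl hσ2
    have bq := H.abs_halfLap_zero_sq_le hN0 hN hl hσ x
    rw [show x - 3 * lam ^ 2 = 0 by rw [l2]; ring, zero_mul, sub_zero] at id0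
    norm_num at b1
    rw [hw] at b0 bq
    rw [abs_of_pos hx0, mul_assoc 15, mul_inv_cancel₀ hx0.ne'] at b0
    set A := halfLap 0 lam x σ (fun y => y * u y - 3 * u₂ y + 9 * u y ^ 2)
    set B := halfLap 1 lam x σ u
    set Q := halfLap 0 lam x σ (fun y => u y ^ 2)
    have t : 3 * |lam * u x + σ * u₁ x| ≤ |A| + |B| + 9 * |Q| := by
      have e1 : |3 * (lam * u x + σ * u₁ x)| = 3 * |lam * u x + σ * u₁ x| := by
        rw [abs_mul]; norm_num
      have e2 : |σ * B| = |B| := by rw [abs_mul, hσa, one_mul]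
      have e3 : |9 * Q| = 9 * |Q| := by rw [abs_mul]; norm_num
      rw [← e1, ← e2, ← e3, id0]
      exact (abs_sub _ _).trans (add_le_add_left (abs_sub _ _) _)
    have tB : lam * |B| ≤ 15 * ε := by
      calc _ ≤ lam * (15 * ε / lam) := by gcongr
        _ = _ := by field_simp
    have tQ : lam * |Q| ≤ N / 32 * (5 / 2) := by
      calc _ ≤ lam * (N / 32 * (1 / lam + 1 / lam ^ 2)) := by gcongr
        _ = N / 32 * (1 + 1 / lam) := by field_simp
        _ ≤ N / 32 * (1 + 1 / (2 / 3)) := by gcongr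
        _ = _ := by norm_num
    have tμ : (x⁻¹) ^ 3 ≤ (1 / 2) ^ 3 := by gcongr
    have tl : 4000 * ε * (1 + Real.log (lam / x⁻¹)) ≤ 4000 * ε * (1 + 2 * Real.log x) := by
      gcongr
    have tε : ε * (15 * 1 + 60 + 180 * x⁻¹ ^ 3) ≤ ε * (15 * 1 + 60 + 180 * (1 / 2) ^ 3) := by
      gcongr
    have tt := mul_le_mul_of_nonneg_left t hl.le
    nlinarith
  have k1 := key 1 (Or.inl rfl)
  have k2 := key (-1) (Or.inr rfl)
  set R := 8000 * ε * (1 + Real.log x) + N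
  rw [one_mul] at k1
  rw [neg_one_mul, ← sub_eq_add_neg] at k2
  have au : lam * |u x| ≤ (|lam * u x + u₁ x| + |lam * u x - u₁ x|) / 2 := by
    rw [← abs_of_pos hl, ← abs_mul, abs_of_pos hl]
    have := abs_add_le (lam * u x + u₁ x) (lam * u x - u₁ x)
    rw [show lam * u x + u₁ x + (lam * u x - u₁ x) = 2 * (lam * u x) by ring, abs_mul,
      abs_of_pos (by norm_num : (0:ℝ) < 2)] at this
    linarith
  have au₁ : |u₁ x| ≤ (|lam * u x + u₁ x| + |lam * u x - u₁ x|) / 2 := by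
    have := abs_sub (lam * u x + u₁ x) (lam * u x - u₁ x)
    rw [show lam * u x + u₁ x - (lam * u x - u₁ x) = 2 * u₁ x by ring, abs_mul,
      abs_of_pos (by norm_num : (0:ℝ) < 2)] at this
    linarith
  constructor
  · calc x * |u x| = 3 * lam * (lam * |u x|) := by linear_combination (-3 * |u x|) * l2
      _ ≤ 3 * lam * ((|lam * u x + u₁ x| + |lam * u x - u₁ x|) / 2) := by gcongr
      _ ≤ R := by linarith
  · have hs : √x ≤ 3 * lam := Real.sqrt_le_iff.mpr ⟨by positivity, by nlinarith⟩
    calc √x * |u₁ x| ≤ 3 * lam * ((|lam * u x + u₁ x| + |lam * u x - u₁ x|) / 2) := by gcongr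
      _ ≤ R := by linarith

theorem oscillatory_le (H : EllipticBounds ε K u u₁ u₂) (hε : 0 < ε) {N : ℝ} (hN0 : 0 ≤ N)
    (hN : ∀ y, |u y| ≤ N * growthWeight y) {x : ℝ} (hx : x ≤ 2) :
    |u x| ≤ (8000 * ε + N / 2) * growthWeight x := by
  have h1 := one_le_growthWeight x
  have hxw : |x| ≤ 2 * growthWeight x := by
    rw [growthWeight, abs_le]
    constructor <;> linarith [le_max_left (-x) 0, le_max_right (-x) 0]
  have bs := H.avg_zero (growthWeight x) x (by linarith)
  have id1 := H.identity_zero (σ := 1) (by linarith : 0 < growthWeight x) (by norm_num) x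
  have id2 := H.identity_zero (σ := -1) (by linarith : 0 < growthWeight x) (by norm_num) x
  have a1 := H.abs_halfLap_zero_le (σ := 1) hN0 hN (by linarith : 0 < growthWeight x) le_rfl
    (by norm_num) x
  have a2 := H.abs_halfLap_zero_le (σ := -1) hN0 hN (by linarith : 0 < growthWeight x) le_rfl
    (by norm_num) x
  have b1 := H.avg 0 (growthWeight x) 1 x (by linarith) (by norm_num)
  have b2 := H.avg 0 (growthWeight x) (-1) x (by linarith) (by norm_num)
  have q1 := H.abs_halfLap_zero_sq_le hN0 hN (by linarith : 0 < growthWeight x) (Or.inl rfl) x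
  have q2 := H.abs_halfLap_zero_sq_le hN0 hN (by linarith : 0 < growthWeight x) (Or.inr rfl) x
  set lam := growthWeight x
  have hl : 0 < lam := by linarith
  set A1 := halfLap 0 lam x 1 (fun y => y * u y - 3 * u₂ y + 9 * u y ^ 2)
  set A2 := halfLap 0 lam x (-1) (fun y => y * u y - 3 * u₂ y + 9 * u y ^ 2)
  set B1 := halfLap 1 lam x 1 u
  set B2 := halfLap 1 lam x (-1) u
  set Q1 := halfLap 0 lam x 1 (fun y => u y ^ 2)
  set Q2 := halfLap 0 lam x (-1) (fun y => u y ^ 2)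
  set S := halfLap 0 lam x 1 u + halfLap 0 lam x (-1) u with hS
  rw [div_self hl.ne', Real.log_one] at a1 a2
  norm_num at b1 b2
  have hd : |x - 3 * lam ^ 2| ≤ 5 * lam ^ 2 := by
    refine (abs_sub _ _).trans ?_
    rw [abs_of_pos (by positivity : 0 < 3 * lam ^ 2)]
    nlinarith
  have id : 6 * (lam * u x) = A1 + A2 - (x - 3 * lam ^ 2) * S - B1 + B2 - 9 * Q1 - 9 * Q2 := by
    rw [hS]
    linear_combination id1 + id2
  have t : 6 * (lam * |u x|) ≤ |A1| + |A2| + 5 * lam ^ 2 * |S| + |B1| + |B2| + 9 * |Q1|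
      + 9 * |Q2| := by
    have e : 6 * (lam * |u x|) = |6 * (lam * u x)| := by
      rw [abs_mul, abs_mul, abs_of_pos hl]
      norm_num
    have e1 : |9 * Q1| = 9 * |Q1| := by rw [abs_mul]; norm_num
    have e2 : |9 * Q2| = 9 * |Q2| := by rw [abs_mul]; norm_num
    have e3 : |(x - 3 * lam ^ 2) * S| ≤ 5 * lam ^ 2 * |S| := by
      rw [abs_mul]
      gcongr
    rw [e, ← e1, ← e2, id]
    refine (abs_sub _ _).trans (add_le_add_left ?_ _)
    refine (abs_sub _ _).trans (add_le_add_left ?_ _)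
    refine (abs_add_le _ _).trans (add_le_add_left ?_ _)
    refine (abs_sub _ _).trans (add_le_add_left ?_ _)
    exact (abs_sub _ _).trans (add_le_add (abs_add_le _ _) e3)
  have sq1 : 1 ≤ lam ^ 2 := by nlinarith
  have sq2 : lam ≤ lam ^ 2 := by nlinarith
  have cube : lam ^ 2 ≤ lam ^ 3 := pow_le_pow_right₀ h1 (by norm_num)
  have p1 : ε * (15 * |x| * lam + 60 + 180 * lam ^ 3) ≤ ε * (270 * lam ^ 3) := by
    have c1 : |x| * lam ≤ 2 * lam * lam := by gcongr
    gcongr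
    linarith
  have A_le : ∀ A : ℝ, lam * |A| ≤ 4000 * ε * (1 + 0) + ε * (15 * |x| * lam + 60 + 180 * lam ^ 3)
      + 9 * (N / 32) * lam → |A| ≤ 4270 * ε * lam ^ 2 + 9 * (N / 32) := fun A hA => by
    refine le_of_mul_le_mul_left (hA.trans ?_) hl
    have : ε ≤ ε * lam ^ 3 := le_mul_of_one_le_right hε.le (sq1.trans cube)
    linarith
  have A1_le := A_le A1 a1
  have A2_le := A_le A2 a2
  have B_le : 15 * ε / lam ≤ 15 * ε * lam ^ 2 := by
    rw [div_le_iff₀ hl, mul_assoc]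
    exact le_mul_of_one_le_right (by positivity) (by linarith)
  have Q_le : N / 32 * (lam / lam + 1 / lam ^ 2) ≤ N / 32 * 2 := by
    rw [div_self hl.ne']
    have : 1 / lam ^ 2 ≤ 1 := div_le_one_of_le₀ sq1 (by positivity)
    gcongr
    linarith
  have S_le : 5 * lam ^ 2 * |S| ≤ 5 * lam ^ 2 * (30 * ε) := by gcongr
  have pos : 0 ≤ ε * lam ^ 2 := by positivity
  have fin : 6 * (lam * |u x|) ≤ 9000 * ε * lam ^ 2 + 2 * N := by linarith
  refine le_of_mul_le_mul_left (a := 6 * lam) ?_ (by positivity)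
  have : N ≤ N * lam ^ 2 := le_mul_of_one_le_right hN0 sq1
  linarith

/-- The pointwise estimate in the elliptic region, at time `1`. -/
theorem elliptic (H : EllipticBounds ε K u u₁ u₂) (hε : 0 < ε) {x : ℝ} (hx : 2 ≤ x) :
    x * |u x| + √x * |u₁ x| ≤ 48000 * ε * (1 + Real.log x) := by
  have hw : ∀ y, 0 < growthWeight y := fun y => one_pos.trans_le (one_le_growthWeight y)
  set N := ⨆ y, |u y| / growthWeight y with hNdef
  have bdd : BddAbove (range fun y => |u y| / growthWeight y) := by
    refine ⟨1 / 32, ?_⟩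
    rintro _ ⟨y, rfl⟩
    rw [div_le_iff₀ (hw y)]
    linarith [H.small y, one_le_growthWeight y]
  have hN : ∀ y, |u y| ≤ N * growthWeight y := fun y =>
    (div_le_iff₀ (hw y)).mp (le_ciSup bdd y)
  have hN0 : 0 ≤ N := Real.iSup_nonneg fun y => div_nonneg (abs_nonneg _) (hw y).le
  have step : N ≤ 8000 * ε + N / 2 := by
    refine ciSup_le fun y => ?_
    rw [div_le_iff₀ (hw y)]
    rcases le_total y 2 with hy | hy
    · exact H.oscillatory_le hε hN0 hN hy
    · have h := (H.elliptic_le hε hN0 hN hy).1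
      have hl := Real.log_le_sub_one_of_pos (by linarith : 0 < y)
      have h2 : y * |u y| ≤ y * (8000 * ε + N / 2) := by
        refine h.trans ?_
        nlinarith
      refine (le_of_mul_le_mul_left h2 (by linarith)).trans ?_
      exact le_mul_of_one_le_right (by positivity) (one_le_growthWeight y)
  obtain ⟨h1, h2⟩ := H.elliptic_le hε hN0 hN hx
  have hlog : 0 ≤ Real.log x := Real.log_nonneg (by linarith)
  have : 0 ≤ ε * Real.log x := by positivity
  nlinarith

end EllipticBounds

theorem halfLap_const_mul_comp_mul (n : ℕ) {l : ℝ} (hl : 0 < l) (a μ x₀ σ : ℝ) (g : ℝ → ℝ) :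
    halfLap n μ x₀ σ (fun y => a * g (l * y))
      = a / l ^ (n + 1) * halfLap n (μ / l) (l * x₀) σ g := by
  have h := integral_comp_mul_left_Ioi'
    (fun s => s ^ n * Real.exp (-(μ / l * s)) * g (l * x₀ + σ * s)) 0 hl
  rw [mul_zero] at h
  rw [halfLap, halfLap, ← h, smul_eq_mul, ← integral_const_mul, ← integral_const_mul]
  refine integral_congr_ae (Filter.Eventually.of_forall fun s => ?_)
  have e1 : μ / l * (l * s) = μ * s := by field_simp
  have e2 : l * (x₀ + σ * s) = l * x₀ + σ * (l * s) := by ring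
  simp only [e1, e2, mul_pow]
  field_simp
  ring

theorem exists_schwartz_eq_LNL (t : ℝ) (u : 𝓢(ℝ, ℝ)) : ∃ f : 𝓢(ℝ, ℝ), ⇑f = LNL t u := by
  refine ⟨smulLeftCLM ℝ (fun x : ℝ => x) u - (3 * t) • derivCLM ℝ ℝ (derivCLM ℝ ℝ u)
    + (9 * t) • smulLeftCLM ℝ u u, ?_⟩
  ext x
  have h2 : iteratedDeriv 2 u x = deriv (deriv u) x := by
    rw [iteratedDeriv_succ, iteratedDeriv_one]
  have h1 : ⇑(derivCLM ℝ ℝ u) = deriv u := by ext; rfl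
  simp only [add_apply, sub_apply, smul_apply, smul_eq_mul,
    smulLeftCLM_apply_apply u.hasTemperateGrowth,
    smulLeftCLM_apply_apply Function.HasTemperateGrowth.id', derivCLM_apply, h1, LNL, h2]
  ring

theorem BesovNorm_nonneg (u : ℝ → ℝ) : 0 ≤ BesovNorm u :=
  Real.iSup_nonneg fun j => by positivity

theorem HsNorm_nonneg (s : ℝ) (u : ℝ → ℝ) : 0 ≤ HsNorm s u := by
  rw [HsNorm]
  positivity

theorem ellipticBounds_rescale {l ε : ℝ} (hl : 0 < l) (hε : 0 < ε) (u : 𝓢(ℝ, ℝ))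
    (hsmall : ∀ x, l ^ 2 * |u x| ≤ 1 / 32) (hB : BesovNorm u ≤ ε)
    (hH : HsNorm (1 / 2) (LNL (l ^ 3) u) ≤ ε) :
    ∃ K, EllipticBounds (l * ε) K (fun y => l ^ 2 * u (l * y)) (fun y => l ^ 3 * deriv u (l * y))
      (fun y => l ^ 4 * iteratedDeriv 2 u (l * y)) := by
  obtain ⟨f, hf⟩ := exists_schwartz_eq_LNL (l ^ 3) u
  rw [← hf] at hH
  have h1 : ⇑(derivCLM ℝ ℝ u) = deriv u := by ext; rfl
  have h2 : ⇑(derivCLM ℝ ℝ (derivCLM ℝ ℝ u)) = iteratedDeriv 2 u := by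
    ext x
    rw [iteratedDeriv_succ, iteratedDeriv_one, ← h1]
    rfl
  have bdd : ∀ g : 𝓢(ℝ, ℝ), ∃ K, ∀ y, |g y| ≤ K := fun g =>
    ⟨_, fun y => SchwartzMap.norm_le_seminorm ℝ g y⟩
  obtain ⟨K0, hK0⟩ := bdd u
  obtain ⟨K1, hK1⟩ := bdd (derivCLM ℝ ℝ u)
  obtain ⟨K2, hK2⟩ := bdd (derivCLM ℝ ℝ (derivCLM ℝ ℝ u))
  rw [h1] at hK1
  rw [h2] at hK2
  have hfv : (fun y => y * (l ^ 2 * u (l * y)) - 3 * (l ^ 4 * iteratedDeriv 2 u (l * y))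
      + 9 * (l ^ 2 * u (l * y)) ^ 2) = fun y => l * f (l * y) := by
    ext y
    rw [hf, LNL]
    ring
  have scale : ∀ y, HasDerivAt (fun y : ℝ => l * y) l y := fun y => by
    simpa using (hasDerivAt_id y).const_mul l
  have bnd : ∀ (k : ℕ) (g : ℝ → ℝ) (B : ℝ), (∀ y, |g y| ≤ B) →
      ∀ y, |l ^ k * g (l * y)| ≤ l ^ k * B := fun k g B hg y => by
    rw [abs_mul, abs_of_pos (by positivity)]
    gcongr
    exact hg _
  refine ⟨max (l ^ 2 * K0) (max (l ^ 3 * K1) (l ^ 4 * K2)), ?_⟩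
  constructor
  · intro y
    refine (((u.differentiableAt.hasDerivAt).comp y (scale y)).const_mul (l ^ 2)).congr_deriv ?_
    ring
  · intro y
    have := (derivCLM ℝ ℝ u).differentiableAt (x := l * y) |>.hasDerivAt
    rw [h1] at this
    refine ((this.comp y (scale y)).const_mul (l ^ 3)).congr_deriv ?_
    rw [iteratedDeriv_succ, iteratedDeriv_one]
    ring
  · rw [← h2]
    exact continuous_const.mul ((SchwartzMap.continuous _).comp (by fun_prop))
  · exact fun y => (bnd 2 _ _ hK0 y).trans (le_max_left _ _)
  · exact fun y => (bnd 3 _ _ hK1 y).trans ((le_max_left _ _).trans (le_max_right _ _))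
  · exact fun y => (bnd 4 _ _ hK2 y).trans ((le_max_right _ _).trans (le_max_right _ _))
  · intro y
    rw [abs_mul, abs_of_pos (by positivity)]
    exact hsmall _
  · intro n μ σ x₀ hμ hσ
    rw [halfLap_const_mul_comp_mul _ hl, abs_mul, abs_of_pos (by positivity)]
    calc _ ≤ l ^ 2 / l ^ (n + 1 + 1) * (15 * (n + 1).factorial * ε / (μ / l) ^ (n + 1)) := by
          gcongr
          exact abs_halfLap_le n (by positivity) hσ _ hε u hB
      _ = _ := by
          rw [div_pow]
          field_simp
          ring
  · intro μ x₀ hμ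
    rw [halfLap_const_mul_comp_mul _ hl, halfLap_const_mul_comp_mul _ hl, ← mul_add, abs_mul,
      abs_of_pos (by positivity)]
    calc _ ≤ l ^ 2 / l ^ (0 + 1) * (30 * ε) := by
          gcongr
          exact abs_halfLap_zero_add_le (by positivity) _ hε u hB
      _ = _ := by
          field_simp
          ring
  · intro μ lam σ x₀ hμ h hσ
    rw [hfv, halfLap_const_mul_comp_mul _ hl, halfLap_const_mul_comp_mul _ hl]
    have hl' : 0 < lam := hμ.trans_le h
    have := abs_halfLap_sub_le (lam := lam / l) (by positivity : 0 < μ / l) (by gcongr) hσ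
      (l * x₀) hε f hH
    rw [div_div_div_cancel_right₀ hl.ne'] at this
    convert this using 2
    · congr 1
      · norm_num [hl.ne']
      · rw [← mul_assoc]
        congr 1
        field_simp
    · field_simp

/-- Nonlinear Klainerman-Sobolev inequality in the elliptic region. -/
theorem nonlinear_klainerman_sobolev_elliptic :
    ∃ C c : ℝ, 0 < C ∧ 0 < c ∧
      ∀ t ε M : ℝ, 0 < t → 0 < ε → 1 ≤ M → M * ε * t ^ ((1:ℝ)/3) ≤ c →
      ∀ u : 𝓢(ℝ, ℝ), Bootstrap M ε t ⇑u →
        BesovNorm ⇑u + HsNorm ((1:ℝ)/2) (LNL t ⇑u) ≤ ε →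
        ∀ x : ℝ, 2 * t ^ ((1:ℝ)/3) ≤ x →
          jb t x * |u x| + t ^ ((1:ℝ)/2) * jb t x ^ ((1:ℝ)/2) * |deriv (⇑u) x|
            ≤ C * ε * Real.log (t ^ (-(1:ℝ)/3) * jb t x) := by
  refine ⟨400000, 1 / 32, by norm_num, by norm_num, fun t ε M ht hε hM hc u hboot hnorm x hx => ?_⟩
  set l := t ^ ((1:ℝ) / 3) with hldef
  have hl : 0 < l := by positivity
  have ht3 : t = l ^ 3 := by
    rw [hldef, ← Real.rpow_natCast, ← Real.rpow_mul ht.le]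
    norm_num
  have ht23 : t ^ ((2:ℝ) / 3) = l ^ 2 := by
    rw [hldef, ← Real.rpow_natCast, ← Real.rpow_mul ht.le]
    norm_num
  have htinv : t ^ (-(1:ℝ) / 3) = l⁻¹ := by
    rw [hldef, ← Real.rpow_neg ht.le]
    norm_num
  have hjb : ∀ y, jb t y = √(y ^ 2 + l ^ 2) := fun y => by rw [jb, ht23, Real.sqrt_eq_rpow]
  have hjl : ∀ y, l ≤ jb t y := fun y => by
    rw [hjb]
    exact Real.le_sqrt_of_sq_le (by nlinarith [sq_nonneg y])
  have hsmall : ∀ y, l ^ 2 * |u y| ≤ 1 / 32 := fun y => by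
    have h1 := (hboot y).1
    have h2 : jb t y ^ (-(1:ℝ) / 4) ≤ l ^ (-(1:ℝ) / 4) :=
      Real.rpow_le_rpow_of_nonpos hl (hjl y) (by norm_num)
    have h3 : t ^ (-(1:ℝ) / 4) * l ^ (-(1:ℝ) / 4) = l⁻¹ := by
      rw [hldef, ← Real.rpow_mul ht.le, ← Real.rpow_add ht, ← Real.rpow_neg ht.le]
      norm_num
    calc l ^ 2 * |u y| ≤ l ^ 2 * (M * ε * t ^ (-(1:ℝ) / 4) * l ^ (-(1:ℝ) / 4)) := by
          gcongr
          exact h1.trans (by gcongr)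
      _ = M * ε * l := by
          rw [mul_assoc (M * ε), h3]
          field_simp
      _ ≤ 1 / 32 := hc
  have hB : BesovNorm u ≤ ε := by linarith [HsNorm_nonneg ((1:ℝ) / 2) (LNL t u)]
  have hH : HsNorm (1 / 2) (LNL (l ^ 3) u) ≤ ε := by
    rw [← ht3]
    linarith [BesovNorm_nonneg u]
  obtain ⟨K, H⟩ := ellipticBounds_rescale hl hε u hsmall hB hH
  set y := x / l with hy
  have hxy : x = l * y := by rw [hy]; field_simp
  have hy2 : 2 ≤ y := by rwa [hy, le_div_iff₀ hl]
  have hy0 : 0 < y := by linarith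
  have main := H.elliptic (by positivity) hy2
  simp only [← hxy, abs_mul, abs_of_pos (pow_pos hl _)] at main
  have hjx : jb t x = l * √(y ^ 2 + 1) := by
    rw [hjb, hxy, show (l * y) ^ 2 + l ^ 2 = l ^ 2 * (y ^ 2 + 1) by ring,
      Real.sqrt_mul (by positivity), Real.sqrt_sq hl.le]
  have hjy : jb t x ≤ 2 * l * y := by
    have : √(y ^ 2 + 1) ≤ 2 * y := Real.sqrt_le_iff.mpr ⟨by positivity, by nlinarith⟩
    rw [hjx]
    nlinarith
  have hlog : 1 + Real.log y ≤ 3 * Real.log (t ^ (-(1:ℝ) / 3) * jb t x) := by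
    rw [htinv, hjx, inv_mul_cancel_left₀ hl.ne']
    have h1 : Real.log y ≤ Real.log √(y ^ 2 + 1) :=
      Real.log_le_log hy0 (Real.le_sqrt_of_sq_le (by linarith))
    have h2 : Real.log 2 ≤ Real.log y := Real.log_le_log (by norm_num) hy2
    linarith [Real.log_two_gt_d9]
  have hsq : t ^ ((1:ℝ) / 2) * jb t x ^ ((1:ℝ) / 2) ≤ 2 * (l ^ 2 * √y) := by
    rw [← Real.sqrt_eq_rpow, ← Real.sqrt_eq_rpow, ← Real.sqrt_mul ht.le]
    refine Real.sqrt_le_iff.mpr ⟨by positivity, ?_⟩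
    rw [mul_pow, mul_pow, Real.sq_sqrt hy0.le]
    have := mul_le_mul_of_nonneg_left hjy ht.le
    rw [ht3] at this ⊢
    nlinarith [this, mul_pos (pow_pos hl 4) hy0]
  have key : jb t x * |u x| + t ^ ((1:ℝ) / 2) * jb t x ^ ((1:ℝ) / 2) * |deriv u x|
      ≤ 2 / l * (y * (l ^ 2 * |u x|) + √y * (l ^ 3 * |deriv u x|)) := by
    calc _ ≤ 2 * l * y * |u x| + 2 * (l ^ 2 * √y) * |deriv u x| := by gcongr
      _ = _ := by field_simp
  refine key.trans ?_
  calc _ ≤ 2 / l * (48000 * (l * ε) * (3 * Real.log (t ^ (-(1:ℝ) / 3) * jb t x))) := by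
        gcongr
        exact main.trans (by gcongr)
    _ = 288000 * ε * Real.log (t ^ (-(1:ℝ) / 3) * jb t x) := by
        field_simp
        ring
    _ ≤ _ := by
        gcongr
        · linarith [Real.log_nonneg (by linarith : 1 ≤ y)]
        · norm_num
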